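/- arXiv:0810.4457 — 4 statements merged into one kernel-verified Lean document; each statement's English description precedes it below -/
import Mathlib

section
/- Let p = (p₁,…,p_m) ∈ ℝ^m and let B ⊆ ℝ be such that B ∪ {p₁,…,p_m} is a basis of ℝ for the exponential algebraic closure pregeometry: every real number is exponentially algebraic over B ∪ {p₁,…,p_m}, and no element of B ∪ {p₁,…,p_m} is exponentially algebraic over the remaining elements. Let C = ecl(B) be the set of reals exponentially algebraic over B (a subfield of ℝ). Then for every n and every tuple z = (z₁,…,zₙ) ∈ ℝⁿ: td(p₁,…,p_m, z₁,…,zₙ, exp(p₁),…,exp(p_m), exp(z₁),…,exp(zₙ) / C) − ldim_ℚ({p₁,…,p_m, z₁,…,zₙ}/C) ≥ m. -/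
/-- `x` is exponentially algebraic over `A ⊆ ℝ`: there are `n ≥ 1`, a tuple `xs` with
`xs 0 = x`, and `n` exponential polynomials (polynomials in variables `X₁,…,Xₙ,Y₁,…,Yₙ`,
with coefficients in the subring generated by `A ∪ ℤ`, where `Yⱼ` stands for `exp Xⱼ`)
vanishing at `(xs, exp xs)` with nonvanishing Jacobian determinant there; the `(i,j)`
Jacobian entry is the total derivative `∂fᵢ/∂Xⱼ + exp(xⱼ)·∂fᵢ/∂Yⱼ` at `(xs, exp xs)`. -/
def IsExpAlgebraicOver (A : Set ℝ) (x : ℝ) : Prop :=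
  ∃ (n : ℕ) (hn : 0 < n) (xs : Fin n → ℝ)
    (f : Fin n → MvPolynomial (Fin n ⊕ Fin n) ℝ),
    xs ⟨0, hn⟩ = x ∧
    (∀ i m, MvPolynomial.coeff m (f i) ∈ Subring.closure A) ∧
    (∀ i, MvPolynomial.eval (Sum.elim xs fun j => Real.exp (xs j)) (f i) = 0) ∧
    (Matrix.of fun i j =>
        MvPolynomial.eval (Sum.elim xs fun j => Real.exp (xs j))
          (MvPolynomial.pderiv (Sum.inl j) (f i)) +
        Real.exp (xs j) *
          MvPolynomial.eval (Sum.elim xs fun j => Real.exp (xs j))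
            (MvPolynomial.pderiv (Sum.inr j) (f i))).det ≠ 0

/-- `x` is exponentially algebraic (over `∅`, i.e. with integer coefficients). -/
def IsExpAlgebraic (x : ℝ) : Prop := IsExpAlgebraicOver ∅ x

/-- `td X Y` : the transcendence degree of the field `ℚ(X ∪ Y)` over `ℚ(Y)`,
realized as the supremum of the cardinalities of subsets of `ℚ(X ∪ Y)` that are
algebraically independent over `ℚ(Y)`. -/
noncomputable def td {F : Type*} [Field F] (X Y : Set F) : Cardinal :=
  ⨆ s : {s : Set F // s ⊆ ↑(Subfield.closure (X ∪ Y)) ∧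
      AlgebraicIndependent ↥(Subfield.closure Y) ((↑) : s → F)}, Cardinal.mk s.1

/-- `ldim K X Y` : the dimension of the `K`-vector space `span_K(X ∪ Y) / span_K(Y)`,
realized as the rank of the image of `span_K(X ∪ Y)` in `F / span_K(Y)`. -/
noncomputable def ldim (K : Type*) {F : Type*} [DivisionRing K] [AddCommGroup F]
    [Module K F] (X Y : Set F) : ℕ :=
  Module.finrank K
    (Submodule.map (Submodule.span K Y).mkQ (Submodule.span K (X ∪ Y)))

open Polynomial in
theorem Derivation.eq_zero_of_isAlgebraic {K L M : Type*} [Field K] [Field L] [CharZero K]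
    [Algebra K L] [AddCommGroup M] [Module K M] [Module L M] [IsScalarTower K L M]
    (D : Derivation K L M) {x : L} (hx : IsAlgebraic K x) : D x = 0 := by
  have h := D.map_aeval (minpoly K x) x
  rw [minpoly.aeval, map_zero] at h
  have hs : aeval x (derivative (minpoly K x)) ≠ 0 :=
    (minpoly.irreducible hx.isIntegral).separable.aeval_derivative_ne_zero (minpoly.aeval K x)
  exact (smul_eq_zero.mp h.symm).resolve_left hs

theorem exists_derivation_of_formallyEtale {R A L : Type*} [CommRing R] [CommRing A] [CommRing L]
    [Algebra R A] [Algebra R L] [Algebra A L] [IsScalarTower R A L] [Algebra.FormallyEtale A L]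
    (D : Derivation R A L) :
    ∃ D' : Derivation R L L, ∀ a, D' (algebraMap A L a) = D a := by
  let e := KaehlerDifferential.tensorKaehlerEquivOfFormallyEtale R A L
  let f : Ω[L⁄R] →ₗ[L] L := (D.liftKaehlerDifferential.liftBaseChange L) ∘ₗ e.symm.toLinearMap
  refine ⟨f.compDer (KaehlerDifferential.D R L), fun a => ?_⟩
  simp [f, e, KaehlerDifferential.tensorKaehlerEquivOfFormallyEtale_symm_D_algebraMap]

open Polynomial in
theorem exists_derivation_of_isFractionRing (k K : Type*) [Field k] [Field K]
    [Algebra k[X] K] [IsFractionRing k[X] K] [Algebra k K] [IsScalarTower k k[X] K] :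
    ∃ D : Derivation k K K, D (algebraMap k[X] K X) = 1 := by
  have : Algebra.FormallyEtale k[X] K :=
    Algebra.FormallyEtale.of_isLocalization (nonZeroDivisors k[X])
  obtain ⟨D, hD⟩ := exists_derivation_of_formallyEtale (Polynomial.mkDerivation k (1 : K))
  exact ⟨D, by rw [hD, mkDerivation_X]⟩

section

open Differential
theorem exists_differential_of_isAlgebraic (K L : Type*) [Field K] [Field L] [CharZero K]
    [Differential K] [Algebra K L] [Algebra.IsAlgebraic K L] :
    ∃ _ : Differential L, DifferentialAlgebra K L := by
  have : Algebra.FormallyEtale K L := Algebra.FormallyEtale.of_isSeparable _ _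
  obtain ⟨D, hD⟩ := exists_derivation_of_formallyEtale (R := ℤ) (A := K) (L := L)
    ((Algebra.linearMap K L).compDer Differential.deriv)
  exact ⟨⟨D⟩, @DifferentialAlgebra.mk K L _ _ _ _ ⟨D⟩ fun a => hD a⟩

section
variable {K L : Type*} [Field K] [Field L] [CharZero K] [Differential K] [Differential L]
  [Algebra K L] [DifferentialAlgebra K L] [FiniteDimensional K L]

theorem Differential.deriv_trace (v : L) : (Algebra.trace K L v)′ = Algebra.trace K L v′ := by
  obtain ⟨_, _⟩ := exists_differential_of_isAlgebraic K (AlgebraicClosure K)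
  apply (algebraMap K (AlgebraicClosure K)).injective
  rw [← deriv_algebraMap, trace_eq_sum_embeddings (AlgebraicClosure K),
    trace_eq_sum_embeddings (AlgebraicClosure K), map_sum]
  exact Finset.sum_congr rfl fun σ _ => (algHom_deriv' σ σ.injective v).symm

theorem Differential.logDeriv_norm {u : L} (hu : u ≠ 0) :
    logDeriv (Algebra.norm K u) = Algebra.trace K L (logDeriv u) := by
  obtain ⟨_, _⟩ := exists_differential_of_isAlgebraic K (AlgebraicClosure K)
  apply (algebraMap K (AlgebraicClosure K)).injective
  rw [← logDeriv_algebraMap, Algebra.norm_eq_prod_embeddings K (AlgebraicClosure K),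
    trace_eq_sum_embeddings (AlgebraicClosure K),
    logDeriv_prod _ _ _ fun σ _ => by simpa using hu]
  refine Finset.sum_congr rfl fun σ _ => ?_
  rw [logDeriv, logDeriv, ← algHom_deriv' σ σ.injective, map_div₀]
end

end

section

open Differential Polynomial

/-- The element `f` of the fraction field of `k[X]` is regular at `0`, with value `r` there. -/
def HasValueAtZero {k K : Type*} [Field k] [Field K] [Algebra k[X] K] (f : K) (r : k) : Prop :=
  ∃ a b : k[X], b.eval 0 ≠ 0 ∧ f * algebraMap k[X] K b = algebraMap k[X] K a ∧
    r * b.eval 0 = a.eval 0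

namespace HasValueAtZero
variable {k K : Type*} [Field k] [Field K] [Algebra k[X] K] {f g : K} {r s : k}

theorem polynomial (p : k[X]) : HasValueAtZero (algebraMap k[X] K p) (p.eval 0) :=
  ⟨p, 1, by simp, by simp, by simp⟩

theorem const [Algebra k K] [IsScalarTower k k[X] K] (r : k) :
    HasValueAtZero (algebraMap k K r) r := by
  rw [IsScalarTower.algebraMap_apply k k[X] K]
  simpa using polynomial (K := K) (C r)

theorem algebraMap_X : HasValueAtZero (algebraMap k[X] K X) (0 : k) := by
  simpa using polynomial (K := K) (X : k[X])

theorem add (hf : HasValueAtZero f r) (hg : HasValueAtZero g s) :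
    HasValueAtZero (f + g) (r + s) := by
  obtain ⟨a, b, hb, hab, hr⟩ := hf
  obtain ⟨c, d, hd, hcd, hs⟩ := hg
  refine ⟨a * d + c * b, b * d, by simp [hb, hd], ?_, ?_⟩
  · simp only [map_mul, map_add]
    linear_combination (algebraMap _ _ d) * hab + (algebraMap _ _ b) * hcd
  · simp only [Polynomial.eval_mul, Polynomial.eval_add]
    linear_combination (Polynomial.eval 0 d) * hr + (Polynomial.eval 0 b) * hs

theorem mul (hf : HasValueAtZero f r) (hg : HasValueAtZero g s) :
    HasValueAtZero (f * g) (r * s) := by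
  obtain ⟨a, b, hb, hab, hr⟩ := hf
  obtain ⟨c, d, hd, hcd, hs⟩ := hg
  refine ⟨a * c, b * d, by simp [hb, hd], ?_, ?_⟩
  · rw [map_mul, map_mul, ← hab, ← hcd]; ring
  · rw [Polynomial.eval_mul, Polynomial.eval_mul, ← hr, ← hs]; ring

theorem inv [IsFractionRing k[X] K] (hf : HasValueAtZero f r) (hr0 : r ≠ 0) :
    HasValueAtZero f⁻¹ r⁻¹ := by
  obtain ⟨a, b, hb, hab, hr⟩ := hf
  have ha : a.eval 0 ≠ 0 := hr ▸ mul_ne_zero hr0 hb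
  have hf0 : f ≠ 0 := by
    rintro rfl
    rw [zero_mul] at hab
    apply ha
    rw [(IsFractionRing.injective k[X] K) (hab.symm.trans (map_zero _).symm), Polynomial.eval_zero]
  refine ⟨b, a, ha, ?_, ?_⟩
  · rw [← hab]; field_simp
  · rw [← hr]; field_simp

theorem sum {ι : Type*} (t : Finset ι) {f : ι → K} {r : ι → k}
    (h : ∀ i ∈ t, HasValueAtZero (f i) (r i)) : HasValueAtZero (∑ i ∈ t, f i) (∑ i ∈ t, r i) := by
  classical
  induction t using Finset.induction_on with
  | empty => simpa using polynomial (K := K) (0 : k[X])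
  | insert i t hi ih =>
    rw [Finset.sum_insert hi, Finset.sum_insert hi]
    exact (h i (by simp)).add (ih fun j hj => h j (by simp [hj]))

theorem unique [IsFractionRing k[X] K] (hf : HasValueAtZero f r) (hg : HasValueAtZero f s) :
    r = s := by
  obtain ⟨a, b, hb, hab, hr⟩ := hf
  obtain ⟨c, d, hd, hcd, hs⟩ := hg
  have h : a * d = c * b := by
    apply IsFractionRing.injective k[X] K
    rw [map_mul, map_mul, ← hab, ← hcd]; ring
  have h := congrArg (Polynomial.eval 0) h
  rw [Polynomial.eval_mul, Polynomial.eval_mul, ← hr, ← hs] at h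
  apply mul_right_cancel₀ (mul_ne_zero hb hd)
  linear_combination h

theorem exists_eq_zpow_mul [IsFractionRing k[X] K] (hf : f ≠ 0) :
    ∃ (n : ℤ) (g : K) (r : k), r ≠ 0 ∧ HasValueAtZero g r ∧ f = algebraMap k[X] K X ^ n * g := by
  have key : ∀ p : k[X], p ≠ 0 → ∃ (m : ℕ) (q : k[X]), q.eval 0 ≠ 0 ∧ p = X ^ m * q := by
    intro p hp
    obtain ⟨q, hq, hd⟩ := p.exists_eq_pow_rootMultiplicity_mul_and_not_dvd hp 0
    rw [dvd_iff_isRoot] at hd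
    exact ⟨_, q, hd, by simpa using hq⟩
  obtain ⟨p, p', hp', rfl⟩ := IsFractionRing.div_surjective (A := k[X]) f
  have hp : p ≠ 0 := by
    rintro rfl
    simp at hf
  obtain ⟨m, q, hq, rfl⟩ := key p hp
  obtain ⟨m', q', hq', rfl⟩ := key p' (nonZeroDivisors.ne_zero hp')
  refine ⟨m - m', _, _, mul_ne_zero hq (inv_ne_zero hq'),
    (polynomial q).mul ((polynomial q').inv hq'), ?_⟩
  have hX : algebraMap k[X] K X ≠ 0 := by simp
  rw [zpow_sub₀ hX, map_mul, map_mul, map_pow, map_pow, zpow_natCast, zpow_natCast,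
    mul_div_mul_comm, div_eq_mul_inv (algebraMap k[X] K q)]

theorem deriv [Algebra k K] [IsScalarTower k k[X] K] [Differential K]
    (hC : ∀ a : k, (algebraMap k K a)′ = 0) (hX : (algebraMap k[X] K (X : k[X]))′ = 1)
    (hf : HasValueAtZero f r) : ∃ s : k, HasValueAtZero f′ s := by
  have hp : ∀ p : k[X], (algebraMap k[X] K p)′ =
      algebraMap k[X] K (derivative p) := by
    intro p
    induction p using Polynomial.induction_on' with
    | add p q hp hq => simp [hp, hq]
    | monomial n a =>
      have hC' : (algebraMap k[X] K (C a))′ = 0 := by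
        rw [← hC a, IsScalarTower.algebraMap_apply k k[X] K]
        rfl
      rw [← C_mul_X_pow_eq_monomial, derivative_C_mul_X_pow, map_mul, map_pow, Derivation.leibniz,
        Derivation.leibniz_pow, hC', hX]
      simp
      ring
  obtain ⟨a, b, hb, hab, hr⟩ := hf
  refine ⟨_, Polynomial.derivative a * b - a * derivative b, b * b, by simp [hb], ?_,
    div_mul_cancel₀ _ (by simp [hb])⟩
  have h := congrArg Differential.deriv hab
  rw [Derivation.leibniz, hp, hp, smul_eq_mul, smul_eq_mul] at h
  simp only [map_mul, map_sub]
  linear_combination (algebraMap k[X] K b) * h - (algebraMap k[X] K (derivative b)) * hab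

end HasValueAtZero

open HasValueAtZero in
theorem IsFractionRing.sum_logDeriv_ne_deriv {k K : Type*} [Field k] [CharZero k] [Field K]
    [Algebra k[X] K] [IsFractionRing k[X] K] [Algebra k K] [IsScalarTower k k[X] K]
    [CharZero K] [Differential K]
    (hC : ∀ a : k, (algebraMap k K a)′ = 0) (hX : (algebraMap k[X] K X)′ = 1)
    {ι : Type*} [Fintype ι] {γ : ι → k} (hγ : LinearIndependent ℤ γ) {N : ι → K}
    (hN : ∀ i, N i ≠ 0) {i₀ : ι} {d : ℕ} (hd : d ≠ 0) (hi₀ : N i₀ = algebraMap k[X] K X ^ d)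
    (w : K) :
    ∑ i, algebraMap k K (γ i) * logDeriv (N i) ≠ w′ := by
  intro h
  set t := algebraMap k[X] K X with ht
  have hX0 : t ≠ 0 := by simp [t]
  have hzpow : ∀ n : ℤ, t * (t ^ n)′ = n * t ^ n := by
    intro n
    rw [Derivation.leibniz_zpow, hX, zpow_sub_one₀ hX0]
    simp; field_simp
  choose n g r hr hg hNg using fun i => exists_eq_zpow_mul (k := k) (hN i)
  have hlog : ∀ i, HasValueAtZero (t * Differential.logDeriv (N i)) (n i : k) := by
    intro i
    obtain ⟨s, hs⟩ := (hg i).deriv hC hX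
    have hg0 : g i ≠ 0 := by
      intro h0
      exact hr i ((h0 ▸ hg i).unique (by simpa using const (K := K) (0 : k)))
    have e : t * Differential.logDeriv (N i) =
        algebraMap k K (n i : k) + t * ((g i)′ * (g i)⁻¹) := by
      rw [hNg i, Differential.logDeriv_mul _ _ (zpow_ne_zero _ hX0) hg0, mul_add,
        Differential.logDeriv, ← mul_div_assoc, hzpow, mul_div_cancel_right₀ _ (zpow_ne_zero _ hX0),
        Differential.logDeriv, div_eq_mul_inv]
      simp
    rw [e]
    simpa using (const (n i : k)).add (algebraMap_X.mul (hs.mul ((hg i).inv (hr i))))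
  have hsum : HasValueAtZero (t * w′) (∑ i, γ i * (n i : k)) := by
    rw [← h, Finset.mul_sum]
    refine sum _ fun i _ => ?_
    rw [mul_left_comm]
    exact (const _).mul (hlog i)
  have hzero : ∑ i, γ i * (n i : k) = 0 := by
    rcases eq_or_ne w 0 with rfl | hw
    · apply hsum.unique
      simpa using const (K := K) (0 : k)
    obtain ⟨m, v, ρ, hρ, hv, rfl⟩ := exists_eq_zpow_mul (k := k) hw
    obtain ⟨s, hs⟩ := hv.deriv hC hX
    have e : t * (t ^ m * v)′ = t ^ m * (algebraMap k K (m : k) * v + t * v′) := by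
      rw [Derivation.leibniz, smul_eq_mul, smul_eq_mul]
      simp only [map_intCast]
      linear_combination v * hzpow m
    have hval : HasValueAtZero (algebraMap k K (m : k) * v + t * v′) ((m : k) * ρ) := by
      simpa using ((const (m : k)).mul hv).add (algebraMap_X.mul hs)
    have hpow : ∀ j : ℕ, j ≠ 0 → HasValueAtZero (t ^ j) (0 : k) := by
      intro j hj
      simpa [hj] using polynomial (K := K) (X ^ j : k[X])
    rw [e] at hsum
    rcases lt_trichotomy m 0 with hm | rfl | hm
    · exfalso
      obtain ⟨j, rfl⟩ : ∃ j : ℕ, m = -(j : ℤ) := ⟨m.natAbs, by omega⟩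
      have h2 := (hpow j (by omega)).mul hsum
      rw [zpow_neg, zpow_natCast, mul_inv_cancel_left₀ (pow_ne_zero _ hX0), zero_mul] at h2
      have h3 := hval.unique h2
      rcases mul_eq_zero.mp h3 with h4 | h4
      · rw [Int.cast_eq_zero] at h4; omega
      · exact hρ h4
    · rw [zpow_zero, one_mul] at hsum
      rw [hsum.unique hval]; simp
    · obtain ⟨j, rfl⟩ : ∃ j : ℕ, m = (j : ℤ) := ⟨m.natAbs, by omega⟩
      rw [zpow_natCast] at hsum
      rw [hsum.unique ((hpow j (by omega)).mul hval), zero_mul]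
  have hn0 : n i₀ = 0 := by
    refine Fintype.linearIndependent_iff.mp hγ n ?_ i₀
    rw [← hzero]
    exact Finset.sum_congr rfl fun i _ => by rw [zsmul_eq_mul, mul_comm]
  have h1 : Differential.logDeriv (N i₀) = d * t⁻¹ := by
    rw [hi₀, Differential.logDeriv_pow, Differential.logDeriv, hX, one_div]
  have h2 := hlog i₀
  rw [h1, hn0] at h2
  have h3 : HasValueAtZero (t * ((d : K) * t⁻¹)) (d : k) := by
    rw [mul_left_comm, mul_inv_cancel₀ hX0, mul_one]
    simpa using const (K := K) (d : k)
  have := h2.unique h3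
  exact hd (by exact_mod_cast this.symm)

end

section

open Differential Polynomial

theorem exists_derivation_sum_logDeriv_ne {k K F : Type*} [Field k] [CharZero k] [Field K] [Field F]
    [Algebra k[X] K] [IsFractionRing k[X] K] [Algebra k K] [IsScalarTower k k[X] K]
    [Algebra K F] [Algebra k F] [IsScalarTower k K F] [Algebra.IsAlgebraic K F]
    {ι : Type*} [Fintype ι] {γ : ι → k} (hγ : LinearIndependent ℤ γ) {u : ι → F}
    (hu : ∀ i, u i ≠ 0) {i₀ : ι} (hi₀ : u i₀ = algebraMap K F (algebraMap k[X] K X)) (v : F) :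
    ∃ E : Derivation k F F, ∑ i, algebraMap k F (γ i) * (E (u i) / u i) ≠ E v := by
  have : CharZero K := charZero_of_injective_algebraMap (algebraMap k K).injective
  obtain ⟨D, hD⟩ := exists_derivation_of_isFractionRing k K
  have : Algebra.FormallyEtale K F := Algebra.FormallyEtale.of_isSeparable _ _
  obtain ⟨E, hE⟩ := exists_derivation_of_formallyEtale ((Algebra.linearMap K F).compDer D)
  refine ⟨E, fun h => ?_⟩
  let _ : Differential K := ⟨D.restrictScalars ℤ⟩
  let _ : Differential F := ⟨E.restrictScalars ℤ⟩
  have : DifferentialAlgebra K F := ⟨hE⟩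
  let S : Set F := insert v (Set.range u)
  let L := IntermediateField.adjoin K S
  have : Finite S := (Set.finite_range u).insert v
  have : FiniteDimensional K L :=
    IntermediateField.finiteDimensional_adjoin fun x _ => Algebra.IsIntegral.isIntegral x
  let u' : ι → L := fun i => ⟨u i, IntermediateField.subset_adjoin K S (Or.inr ⟨i, rfl⟩)⟩
  let v' : L := ⟨v, IntermediateField.subset_adjoin K S (Or.inl rfl)⟩
  have hu' : ∀ i, u' i ≠ 0 := fun i h0 => hu i (congrArg Subtype.val h0)
  have key : ∑ i, algebraMap K L (algebraMap k K (γ i)) * Differential.logDeriv (u' i) = v'′ := by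
    apply (algebraMap L F).injective
    rw [← deriv_algebraMap, map_sum]
    refine (Finset.sum_congr rfl fun i _ => ?_).trans h
    rw [map_mul, ← logDeriv_algebraMap, ← IsScalarTower.algebraMap_apply K L F,
      ← IsScalarTower.algebraMap_apply k K F]
    rfl
  refine IsFractionRing.sum_logDeriv_ne_deriv (k := k) (N := fun i => Algebra.norm K (u' i))
    (fun a => D.map_algebraMap a) hD hγ (fun i => Algebra.norm_ne_zero_iff.mpr (hu' i)) (i₀ := i₀)
    (d := Module.finrank K L) Module.finrank_pos.ne' ?_ (Algebra.trace K L v') ?_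
  · have : u' i₀ = algebraMap K L (algebraMap k[X] K X) := Subtype.ext hi₀
    simp only [this, Algebra.norm_algebraMap]
  · rw [Differential.deriv_trace, ← key, map_sum]
    refine Finset.sum_congr rfl fun i _ => ?_
    rw [Differential.logDeriv_norm (hu' i), ← Algebra.smul_def (algebraMap k K (γ i)),
      map_smul, smul_eq_mul]

theorem isAlgebraic_of_forall_derivation_sum_logDeriv {C F : Type*} [Field C] [CharZero C] [Field F]
    [Algebra C F] {ι : Type*} [Fintype ι] {γ : ι → C} (hγ : LinearIndependent ℤ γ) {u : ι → F}
    (hu : ∀ i, u i ≠ 0) {v : F}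
    (h : ∀ E : Derivation C F F, ∑ i, algebraMap C F (γ i) * (E (u i) / u i) = E v) (i₀ : ι) :
    IsAlgebraic C (u i₀) := by
  by_contra ht
  obtain ⟨T, htT, hT⟩ := exists_isTranscendenceBasis_superset (R := C) (s := {u i₀})
    ((algebraicIndependent_singleton_iff (⟨u i₀, rfl⟩ : ({u i₀} : Set F))).mpr ht)
  rw [Set.singleton_subset_iff] at htT
  let k := IntermediateField.adjoin C (T \ {u i₀})
  have htk : Transcendental k (u i₀) := by
    have h1 := hT.1.transcendental_adjoin (s := {x | (x : F) ≠ u i₀}) (i := ⟨u i₀, htT⟩) (by simp)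
    have h2 : ((↑) : T → F) '' {x | (x : F) ≠ u i₀} = T \ {u i₀} := by
      ext x; simp [and_comm]
    rw [h2] at h1
    open scoped IntermediateField.algebraAdjoinAdjoin in
    exact fun h3 => h1 ((IsFractionRing.isAlgebraic_iff (Algebra.adjoin C (T \ {u i₀})) k F).mpr h3)
  let K := FractionRing k[X]
  let φ : K →+* F := IsFractionRing.lift (g := ((aeval (u i₀) : k[X] →ₐ[k] F) : k[X] →+* F))
    (transcendental_iff_injective.mp htk)
  let _ : Algebra K F := φ.toAlgebra
  have hφ : ∀ p : k[X], algebraMap K F (algebraMap k[X] K p) = aeval (u i₀) p :=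
    fun p => IsFractionRing.lift_algebraMap _ p
  have : IsScalarTower k K F := IsScalarTower.of_algebraMap_eq fun a => by
    rw [IsScalarTower.algebraMap_apply k k[X] K, hφ]
    simp
  have : IsScalarTower C K F := IsScalarTower.of_algebraMap_eq fun a => by
    rw [IsScalarTower.algebraMap_apply C k K, ← IsScalarTower.algebraMap_apply k K F]
    rfl
  have : Algebra.IsAlgebraic K F := by
    have hle : Algebra.adjoin C T ≤ (IsScalarTower.toAlgHom C K F).range := by
      refine Algebra.adjoin_le fun x hx => ?_
      by_cases hxt : x = u i₀
      · exact ⟨algebraMap k[X] K X, by simp [hφ, hxt]⟩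
      · refine ⟨algebraMap k K ⟨x, IntermediateField.subset_adjoin C _ ⟨hx, hxt⟩⟩, ?_⟩
        exact (IsScalarTower.algebraMap_apply k K F _).symm
    have hTa := hT.isAlgebraic
    rw [Subtype.range_coe] at hTa
    refine ⟨fun x => ?_⟩
    have h1 := (hTa.isAlgebraic x).tower_top_of_subalgebra_le hle
    refine h1.of_ringHom_of_comp_eq (algebraMap K F).rangeRestrict (RingHom.id F) ?_ ?_ ?_
    · exact (algebraMap K F).rangeRestrict_surjective
    · exact Function.injective_id
    · rfl
  obtain ⟨E, hE⟩ := exists_derivation_sum_logDeriv_ne (k := k) (K := K)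
    (hγ.map' ((Algebra.linearMap C k).restrictScalars ℤ)
      (LinearMap.ker_eq_bot.mpr (algebraMap C k).injective)) hu (i₀ := i₀) (by simp [hφ]) v
  exact hE (h (E.restrictScalars C))

end

theorem Derivation.map_prod_zpow_div {R F : Type*} [CommRing R] [Field F] [Algebra R F]
    (E : Derivation R F F) {ι : Type*} [Fintype ι] {y : ι → F} (hy : ∀ i, y i ≠ 0) (n : ι → ℤ) :
    E (∏ i, y i ^ n i) / ∏ i, y i ^ n i = ∑ i, n i * (E (y i) / y i) := by
  let _ : Differential F := ⟨E.restrictScalars ℤ⟩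
  have h := Differential.logDeriv_prod ι Finset.univ (fun i => y i ^ n i)
    fun i _ => zpow_ne_zero _ (hy i)
  refine h.trans (Finset.sum_congr rfl fun i _ => ?_)
  change E (y i ^ n i) / y i ^ n i = _
  rw [E.leibniz_zpow, zpow_sub_one₀ (hy i), zsmul_eq_mul, smul_eq_mul]
  have := hy i
  field_simp

/-- A nonzero subspace of a coordinate space which is stable under a set of derivations contains a
nonzero vector whose coordinates are killed by all of these derivations. -/
theorem Submodule.exists_ne_zero_of_forall_derivation {R F : Type*} [CommRing R] [Field F]
    [Algebra R F] {ι : Type*} [Fintype ι] (S : Set (Derivation R F F)) (V : Submodule F (ι → F))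
    (hS : ∀ D ∈ S, ∀ c ∈ V, (fun i => D (c i)) ∈ V) (hV : V ≠ ⊥) :
    ∃ c ∈ V, c ≠ 0 ∧ ∀ D ∈ S, ∀ i, D (c i) = 0 := by
  classical
  have hex : ∃ k, ∃ c ∈ V, c ≠ 0 ∧ (Finset.univ.filter fun i => c i ≠ 0).card = k := by
    obtain ⟨c, hc, h0⟩ := V.exists_mem_ne_zero_of_ne_bot hV
    exact ⟨_, c, hc, h0, rfl⟩
  obtain ⟨c, hc, h0, hcard⟩ := Nat.find_spec hex
  obtain ⟨j, hj⟩ := Function.ne_iff.mp h0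
  rw [Pi.zero_apply] at hj
  refine ⟨(c j)⁻¹ • c, V.smul_mem _ hc, smul_ne_zero (inv_ne_zero hj) h0, fun D hD => ?_⟩
  by_contra! hne
  refine Nat.find_min hex ?_ ⟨_, hS D hD _ (V.smul_mem (c j)⁻¹ hc), Function.ne_iff.mpr hne, rfl⟩
  rw [← hcard]
  refine Finset.card_lt_card (Finset.ssubset_iff_subset_ne.mpr ⟨fun i => ?_, fun h => ?_⟩)
  · simp only [Finset.mem_filter, Finset.mem_univ, true_and]
    exact fun h h' => h (by simp [h'])
  · have h2 : j ∈ Finset.univ.filter fun i => c i ≠ 0 := by simpa using hj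
    rw [← h, Finset.mem_filter, Pi.smul_apply, smul_eq_mul, inv_mul_cancel₀ hj] at h2
    exact h2.2 D.map_one_eq_zero

theorem eq_zero_of_forall_derivation_sum {C F : Type*} [Field C] [CharZero C] [Field F]
    [Algebra C F] {S : Set (Derivation C F F)}
    (hS : ∀ a, (∀ D ∈ S, D a = 0) → a ∈ Set.range (algebraMap C F))
    {ι : Type*} [Fintype ι] {x y : ι → F} (hy : ∀ i, y i ≠ 0)
    (hxy : ∀ D ∈ S, ∀ i, D (y i) = y i * D (x i))
    (hx : ∀ n : ι → ℤ, ∑ i, n i * x i ∈ Set.range (algebraMap C F) → n = 0) {c : ι → F}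
    (hc : ∀ E : Derivation C F F, ∑ i, c i * (E (y i) / y i - E (x i)) = 0) : c = 0 := by
  let V : Submodule F (ι → F) :=
    { carrier := {c | ∀ E : Derivation C F F, ∑ i, c i * (E (y i) / y i - E (x i)) = 0}
      add_mem' := fun {a b} ha hb E => by
        simp only [Pi.add_apply, add_mul, Finset.sum_add_distrib, ha E, hb E, add_zero]
      zero_mem' := fun E => by simp
      smul_mem' := fun a b hb E => by
        simp only [Pi.smul_apply, smul_eq_mul, mul_assoc, ← Finset.mul_sum, hb E, mul_zero] }
  have hVS : ∀ D ∈ S, ∀ c ∈ V, (fun i => D (c i)) ∈ V := by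
    intro D hD c hc E
    have h1 := congrArg D (hc E)
    have h0 : ∑ i, c i * (⁅D, E⁆ (y i) / y i - ⁅D, E⁆ (x i)) = 0 := hc ⁅D, E⁆
    rw [map_zero, map_sum] at h1
    rw [← add_zero (∑ i, _), ← h0, ← Finset.sum_add_distrib, h0, ← h1]
    refine Finset.sum_congr rfl fun i _ => ?_
    have hyi := hy i
    have h2 := hxy D hD i
    simp only [Derivation.commutator_apply, D.leibniz, E.leibniz, map_sub, Derivation.leibniz_div,
      smul_eq_mul, h2]
    field_simp
    ring
  suffices V = ⊥ from (Submodule.mem_bot F).mp (this ▸ hc : c ∈ (⊥ : Submodule F (ι → F)))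
  by_contra hV
  obtain ⟨c, hcV, hc0, hcS⟩ := V.exists_ne_zero_of_forall_derivation S hVS hV
  choose c' hc' using fun i => hS (c i) fun D hD => hcS D hD i
  let M := Submodule.span ℤ (Set.range c')
  have : Module.Finite ℤ M := Module.Finite.span_of_finite ℤ (Set.finite_range c')
  let b := Module.Free.chooseBasis ℤ M
  let N : Module.Free.ChooseBasisIndex ℤ M → ι → ℤ :=
    fun l i => b.repr ⟨c' i, Submodule.subset_span ⟨i, rfl⟩⟩ l
  have hN : ∀ i, c' i = ∑ l, (N l i : C) * (b l : C) := by
    intro i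
    have h1 := congrArg (Subtype.val : M → C) (b.sum_repr ⟨c' i, Submodule.subset_span ⟨i, rfl⟩⟩)
    rw [AddSubmonoidClass.coe_finsetSum] at h1
    refine h1.symm.trans (Finset.sum_congr rfl fun l _ => ?_)
    simp [N]
  have hu : ∀ l, ∏ i, y i ^ N l i ≠ 0 := fun l =>
    Finset.prod_ne_zero_iff.mpr fun i _ => zpow_ne_zero _ (hy i)
  have halg := isAlgebraic_of_forall_derivation_sum_logDeriv (C := C) (F := F)
    (γ := fun l => (b l : C)) (b.linearIndependent.map' M.subtype M.ker_subtype) hu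
    (v := ∑ i, c i * x i) fun E => by
      have h1 : ∑ i, c i * (E (y i) / y i) = E (∑ i, c i * x i) := by
        rw [← sub_eq_zero, map_sum, ← Finset.sum_sub_distrib, ← hcV E]
        refine Finset.sum_congr rfl fun i _ => ?_
        rw [E.leibniz, ← hc' i, E.map_algebraMap]
        simp
        ring
      rw [← h1]
      simp_rw [E.map_prod_zpow_div hy, Finset.mul_sum]
      rw [Finset.sum_comm]
      refine Finset.sum_congr rfl fun i _ => ?_
      rw [← hc' i, hN i, map_sum, Finset.sum_mul]
      refine Finset.sum_congr rfl fun l _ => ?_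
      simp
      ring
  apply hc0
  have hN0 : ∀ l, N l = 0 := by
    refine fun l => hx _ (hS _ fun D hD => ?_)
    have h1 := D.map_prod_zpow_div hy (N l)
    rw [D.eq_zero_of_isAlgebraic (halg l), zero_div] at h1
    rw [map_sum, h1]
    refine Finset.sum_congr rfl fun i _ => ?_
    rw [hxy D hD, mul_div_cancel_left₀ _ (hy i), D.leibniz]
    simp
  ext i
  rw [← hc' i, hN i]
  simp [hN0]

theorem Derivation.eq_zero_of_isAlgebraic_adjoin {C F : Type*} [Field C] [CharZero C] [Field F]
    [Algebra C F] (D : Derivation C F F) {s : Set F} (hs : ∀ b ∈ s, D b = 0) {a : F}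
    (ha : IsAlgebraic (Algebra.adjoin C s) a) : D a = 0 := by
  let K : Subfield F :=
    { carrier := {a | D a = 0}
      mul_mem' := fun {a b} (ha : D a = 0) (hb : D b = 0) => by simp [D.leibniz, ha, hb]
      one_mem' := D.map_one_eq_zero
      add_mem' := fun {a b} (ha : D a = 0) (hb : D b = 0) => by simp [ha, hb]
      zero_mem' := D.map_zero
      neg_mem' := fun {a} (ha : D a = 0) => by simp [ha]
      inv_mem' := fun a (ha : D a = 0) => by simp [D.leibniz_inv, ha] }
  have : CharZero F := charZero_of_injective_algebraMap (algebraMap C F).injective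
  let K' : Subalgebra C F := { K with algebraMap_mem' := fun c => D.map_algebraMap c }
  have h1 : IsAlgebraic K' a :=
    ha.tower_top_of_subalgebra_le (Algebra.adjoin_le (show s ⊆ (K' : Set F) from hs))
  have h2 : IsAlgebraic K a := h1
  let D' : Derivation K F F := Derivation.mk'
    { D.toAddMonoidHom with
      map_smul' := fun (c : K) x => by
        have hc : D c = 0 := c.2
        simp [Subfield.smul_def, D.leibniz, hc] } D.leibniz
  exact D'.eq_zero_of_isAlgebraic h2

theorem exists_algebraicIndependent_of_derivation {C F : Type*} [Field C] [CharZero C] [Field F]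
    [Algebra C F] {S : Set (Derivation C F F)}
    (hS : ∀ a, (∀ D ∈ S, D a = 0) → a ∈ Set.range (algebraMap C F))
    {X : Set F} (hX : X.Finite) {ι κ : Type*} [Fintype ι] [Fintype κ] [DecidableEq κ] {x y : ι → F}
    (hxX : ∀ i, x i ∈ X) (hyX : ∀ i, y i ∈ X) (hy : ∀ i, y i ≠ 0)
    (hxy : ∀ D ∈ S, ∀ i, D (y i) = y i * D (x i))
    (hx : ∀ n : ι → ℤ, ∑ i, n i * x i ∈ Set.range (algebraMap C F) → n = 0)
    {p : κ → F} (hpX : ∀ j, p j ∈ X) {D : κ → Derivation C F F} (hDS : ∀ k, D k ∈ S)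
    (hDp : ∀ k j, D k (p j) = if k = j then 1 else 0) :
    ∃ s ⊆ X, AlgebraicIndependent C ((↑) : s → F) ∧
      Fintype.card ι + Fintype.card κ ≤ s.ncard := by
  obtain ⟨s, -, ⟨hs, hsX⟩, hmax⟩ := exists_maximal_algebraicIndependent (R := C) ∅ X
    (Set.empty_subset _) ((algebraicIndependent_empty_iff C F).mpr (algebraMap C F).injective)
  refine ⟨s, hsX, hs, ?_⟩
  have hsfin : s.Finite := hX.subset hsX
  have : Finite s := hsfin
  have halg : ∀ a ∈ X, IsAlgebraic (Algebra.adjoin C s) a := by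
    intro a ha
    by_contra htr
    have h1 : AlgebraicIndepOn C id (insert a s) := hs.insert (by rwa [Set.image_id])
    have h2 := hmax ⟨h1, Set.insert_subset ha hsX⟩ (Set.subset_insert a s) (Set.mem_insert a s)
    exact htr (isAlgebraic_algebraMap (⟨a, Algebra.subset_adjoin h2⟩ : Algebra.adjoin C s))
  let ev : F → Derivation C F F →ₗ[F] F := fun a =>
    { toFun := fun E => E a
      map_add' := fun _ _ => rfl
      map_smul' := fun _ _ => rfl }
  have hspan : ∀ a ∈ X, ev a ∈ Submodule.span F (ev '' s) := by
    intro a ha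
    have h1 : ⨅ b : s, LinearMap.ker (ev b) ≤ LinearMap.ker (ev a) := by
      intro E hE
      simp only [Submodule.mem_iInf, LinearMap.mem_ker] at hE
      exact E.eq_zero_of_isAlgebraic_adjoin (fun b hb => hE ⟨b, hb⟩) (halg a ha)
    have h2 := mem_span_of_iInf_ker_le_ker h1
    rwa [Set.image_eq_range]
  let w : ι ⊕ κ → Derivation C F F →ₗ[F] F :=
    Sum.elim (fun i => (y i)⁻¹ • ev (y i) - ev (x i)) fun j => ev (p j)
  have hwspan : ∀ i, w i ∈ Submodule.span F (ev '' s) := by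
    rintro (i | j)
    · exact Submodule.sub_mem _ (Submodule.smul_mem _ _ (hspan _ (hyX i))) (hspan _ (hxX i))
    · exact hspan _ (hpX j)
  have hw : LinearIndependent F w := by
    rw [Fintype.linearIndependent_iff]
    intro g hg
    have hE : ∀ E : Derivation C F F, ∑ i, g (Sum.inl i) * (E (y i) / y i - E (x i)) +
        ∑ j, g (Sum.inr j) * E (p j) = 0 := by
      intro E
      have h1 := LinearMap.congr_fun hg E
      rw [Fintype.sum_sum_type, LinearMap.add_apply, LinearMap.sum_apply, LinearMap.sum_apply,
        LinearMap.zero_apply] at h1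
      rw [← h1]
      congr 1
      refine Finset.sum_congr rfl fun i _ => ?_
      simp [w, ev, div_eq_inv_mul]
    have hr : ∀ k, g (Sum.inr k) = 0 := by
      intro k
      have h1 := hE (D k)
      rw [Finset.sum_eq_zero, zero_add] at h1
      · simpa [hDp] using h1
      · intro i _
        rw [hxy _ (hDS k), mul_div_cancel_left₀ _ (hy i), sub_self, mul_zero]
    have hl := eq_zero_of_forall_derivation_sum (c := fun i => g (Sum.inl i)) hS hy hxy hx
      fun E => by simpa [hr] using hE E
    rintro (i | j)
    · exact congrFun hl i
    · exact hr j
  have hfin : (ev '' s).Finite := hsfin.image ev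
  have : Module.Finite F (Submodule.span F (ev '' s)) := Module.Finite.span_of_finite F hfin
  calc Fintype.card ι + Fintype.card κ = Module.finrank F (Submodule.span F (Set.range w)) := by
        rw [finrank_span_eq_card hw, Fintype.card_sum]
    _ ≤ Module.finrank F (Submodule.span F (ev '' s)) :=
        Submodule.finrank_mono (Submodule.span_le.mpr (Set.range_subset_iff.mpr hwspan))
    _ ≤ (ev '' s).ncard := by
        have := hfin.fintype
        rw [Set.ncard_eq_toFinset_card']
        exact finrank_span_le_card _
    _ ≤ s.ncard := Set.ncard_image_le hsfin

theorem td_lt_aleph0 {F : Type*} [Field F] {X : Set F} (hX : X.Finite) (Y : Set F) :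
    td X Y < Cardinal.aleph0 := by
  let K := IntermediateField.adjoin (Subfield.closure Y) X
  have : Algebra.EssFiniteType (Subfield.closure Y) K :=
    IntermediateField.essFiniteType_iff.mpr (IntermediateField.fg_adjoin_of_finite hX)
  have hle : Subfield.closure (X ∪ Y) ≤ K.toSubfield := by
    refine Subfield.closure_le.mpr (Set.union_subset (IntermediateField.subset_adjoin _ X) ?_)
    exact fun y hy => K.algebraMap_mem ⟨y, Subfield.subset_closure hy⟩
  refine lt_of_le_of_lt (ciSup_le' ?_) (trdeg_lt_aleph0 (Subfield.closure Y) K)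
  rintro ⟨s, hs, hind⟩
  have h1 : AlgebraicIndependent (Subfield.closure Y) fun a : s => (⟨a, hle (hs a.2)⟩ : K) :=
    AlgebraicIndependent.of_comp K.val hind
  exact h1.cardinalMk_le_trdeg

theorem add_le_toNat_td {F : Type*} [Field F] [CharZero F] {S : Set (Derivation ℤ F F)}
    {X Y : Set F} (hY : ∀ a, a ∈ Y ↔ ∀ D ∈ S, D a = 0)
    (hX : X.Finite) {ι κ : Type*} [Fintype ι] [Fintype κ] [DecidableEq κ] {x y : ι → F}
    (hxX : ∀ i, x i ∈ X) (hyX : ∀ i, y i ∈ X) (hy : ∀ i, y i ≠ 0)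
    (hxy : ∀ D ∈ S, ∀ i, D (y i) = y i * D (x i))
    (hx : ∀ n : ι → ℤ, ∑ i, n i * x i ∈ Y → n = 0)
    {p : κ → F} (hpX : ∀ j, p j ∈ X) {D : κ → Derivation ℤ F F} (hDS : ∀ k, D k ∈ S)
    (hDp : ∀ k j, D k (p j) = if k = j then 1 else 0) :
    Fintype.card ι + Fintype.card κ ≤ (td X Y).toNat := by
  let C := Subfield.closure Y
  have hC : ∀ a ∈ C, ∀ D ∈ S, D a = 0 := by
    intro a ha D hD
    induction ha using Subfield.closure_induction with
    | mem x hx => exact (hY x).mp hx D hD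
    | one => exact D.map_one_eq_zero
    | add x y _ _ hx hy => simp [hx, hy]
    | neg x _ hx => simp [hx]
    | inv x _ hx => simp [D.leibniz_inv, hx]
    | mul x y _ _ hx hy => simp [D.leibniz, hx, hy]
  have hCY : ∀ a ∈ C, a ∈ Y := fun a ha => (hY a).mpr (hC a ha)
  let S' : Set (Derivation C F F) := {D | D.restrictScalars ℤ ∈ S}
  have hlift : ∀ D ∈ S, ∃ D' ∈ S', ∀ a, D' a = D a := by
    intro D hD
    let D' : Derivation C F F := Derivation.mk'
      { D.toAddMonoidHom with
        map_smul' := fun (c : C) x => by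
          have hc : D c = 0 := hC c c.2 D hD
          simp [Subfield.smul_def, D.leibniz, hc] } D.leibniz
    exact ⟨D', hD, fun _ => rfl⟩
  choose D' hD'S hD' using fun k => hlift (D k) (hDS k)
  have hrange : ∀ a, a ∈ Set.range (algebraMap C F) ↔ a ∈ Y :=
    fun a => ⟨by rintro ⟨c, rfl⟩; exact hCY c c.2, fun h => ⟨⟨a, Subfield.subset_closure h⟩, rfl⟩⟩
  obtain ⟨s, hsX, hs, hcard⟩ := exists_algebraicIndependent_of_derivation (C := C) (S := S')
    (D := D') (fun a ha => (hrange a).mpr ((hY a).mpr fun D hD => by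
      obtain ⟨E, hE, hED⟩ := hlift D hD
      rw [← hED, ha E hE])) hX hxX hyX hy (fun E hE i => hxy _ hE i)
    (fun n hn => hx n ((hrange _).mp hn)) hpX hD'S fun k j => by rw [hD', hDp]
  refine hcard.trans ?_
  rw [← Nat.card_coe_set_eq, Nat.card]
  refine Cardinal.toNat_le_toNat ?_ (td_lt_aleph0 hX Y)
  exact le_ciSup (f := fun s : {s : Set F // s ⊆ ↑(Subfield.closure (X ∪ Y)) ∧
      AlgebraicIndependent ↥(Subfield.closure Y) ((↑) : s → F)} => Cardinal.mk s.1)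
    Cardinal.bddAbove_of_small
    ⟨s, fun a ha => Subfield.subset_closure (Or.inl (hsX ha)), hs⟩

section ExponentialPolynomials

open MvPolynomial

namespace ExpPolynomial

variable {ι : Type*}

/-- Evaluation of an exponential polynomial at a real point. -/
noncomputable def expEval (x : ι → ℝ) : MvPolynomial (ι ⊕ ι) ℝ →+* ℝ :=
  eval (Sum.elim x fun j => Real.exp (x j))

/-- The total derivative of an exponential polynomial with respect to the `j`-th variable. -/
noncomputable def totalDeriv (j : ι) (f : MvPolynomial (ι ⊕ ι) ℝ) : MvPolynomial (ι ⊕ ι) ℝ :=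
  pderiv (Sum.inl j) f + X (Sum.inr j) * pderiv (Sum.inr j) f

/-- The gradient of an exponential polynomial at a real point. -/
noncomputable def grad (x : ι → ℝ) (f : MvPolynomial (ι ⊕ ι) ℝ) : ι → ℝ :=
  fun j => expEval x (totalDeriv j f)

variable (ι) in
/-- The exponential polynomials with coefficients in the subring generated by `A`. -/
noncomputable def coeffsIn (A : Set ℝ) : Subring (MvPolynomial (ι ⊕ ι) ℝ) :=
  (map (Subring.closure A).subtype).range

/-- The exponential polynomials over `A` vanishing at `x`. -/
def vanishing (A : Set ℝ) (x : ι → ℝ) : Set (MvPolynomial (ι ⊕ ι) ℝ) :=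
  {f | f ∈ coeffsIn ι A ∧ expEval x f = 0}

/-- The span of the gradients at `x` of the exponential polynomials over `A` vanishing at `x`. -/
def conormal (A : Set ℝ) (x : ι → ℝ) : Submodule ℝ (ι → ℝ) :=
  Submodule.span ℝ (grad x '' vanishing A x)

/-- The derivations of `ℝ` that vanish on `A` and respect the exponential function. -/
def expDerivations (A : Set ℝ) : Set (Derivation ℤ ℝ ℝ) :=
  {D | (∀ a, D (Real.exp a) = Real.exp a * D a) ∧ ∀ a ∈ A, D a = 0}

variable {A : Set ℝ} {x : ι → ℝ}

theorem mem_coeffsIn {f : MvPolynomial (ι ⊕ ι) ℝ} :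
    f ∈ coeffsIn ι A ↔ ∀ m, coeff m f ∈ Subring.closure A := by
  constructor
  · rintro ⟨g, rfl⟩ m
    simp [coeff_map]
  · intro h
    rw [f.as_sum]
    refine Subring.sum_mem _ fun m _ => ⟨monomial m ⟨_, h m⟩, ?_⟩
    simp [map_monomial]

theorem X_mem_coeffsIn (i : ι ⊕ ι) : X i ∈ coeffsIn ι A := ⟨X i, map_X _ _⟩

theorem C_mem_coeffsIn {a : ℝ} (ha : a ∈ Subring.closure A) : C a ∈ coeffsIn ι A :=
  ⟨C ⟨a, ha⟩, map_C _ _⟩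

theorem totalDeriv_mem_coeffsIn (j : ι) {f : MvPolynomial (ι ⊕ ι) ℝ} (hf : f ∈ coeffsIn ι A) :
    totalDeriv j f ∈ coeffsIn ι A := by
  obtain ⟨g, rfl⟩ := hf
  refine ⟨pderiv (Sum.inl j) g + X (Sum.inr j) * pderiv (Sum.inr j) g, ?_⟩
  simp [totalDeriv, pderiv_map]

@[simp] theorem expEval_X_inl (i : ι) : expEval x (X (Sum.inl i)) = x i := by simp [expEval]

@[simp] theorem expEval_X_inr (i : ι) : expEval x (X (Sum.inr i)) = Real.exp (x i) := by
  simp [expEval]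

@[simp] theorem expEval_C (a : ℝ) : expEval x (C a) = a := by simp [expEval]

@[simp] theorem grad_add (f g : MvPolynomial (ι ⊕ ι) ℝ) : grad x (f + g) = grad x f + grad x g := by
  ext j; simp [grad, totalDeriv]; ring

@[simp] theorem grad_sub (f g : MvPolynomial (ι ⊕ ι) ℝ) : grad x (f - g) = grad x f - grad x g := by
  ext j; simp [grad, totalDeriv]; ring

@[simp] theorem grad_mul (f g : MvPolynomial (ι ⊕ ι) ℝ) :
    grad x (f * g) = expEval x f • grad x g + expEval x g • grad x f := by
  ext j; simp [grad, totalDeriv, Derivation.leibniz]; ring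

@[simp] theorem grad_C (a : ℝ) : grad x (C a) = 0 := by
  ext j; simp [grad, totalDeriv]

@[simp] theorem grad_X_inl [DecidableEq ι] (i : ι) : grad x (X (Sum.inl i)) = Pi.single i 1 := by
  ext j; simp [grad, totalDeriv, pderiv_X, Pi.single_apply, apply_ite, eq_comm]

@[simp] theorem grad_X_inr [DecidableEq ι] (i : ι) :
    grad x (X (Sum.inr i)) = Pi.single i (Real.exp (x i)) := by
  ext j
  by_cases h : j = i
  · subst h; simp [grad, totalDeriv, pderiv_X]
  · simp [grad, totalDeriv, pderiv_X, h, Ne.symm h]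

variable [Fintype ι]

theorem derivation_expEval {D : Derivation ℤ ℝ ℝ} (hD : D ∈ expDerivations A)
    {f : MvPolynomial (ι ⊕ ι) ℝ} (hf : f ∈ coeffsIn ι A) :
    D (expEval x f) = ∑ j, grad x f j * D (x j) := by
  classical
  obtain ⟨g, rfl⟩ := hf
  have hA : ∀ a ∈ Subring.closure A, D a = 0 := fun a ha => by
    induction ha using Subring.closure_induction with
    | mem a ha => exact hD.2 a ha
    | zero => simp
    | one => simp
    | add a b _ _ ha hb => simp [ha, hb]
    | neg a _ ha => simp [ha]
    | mul a b _ _ ha hb => simp [ha, hb]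
  induction g using MvPolynomial.induction_on with
  | C a => simp [hA a a.2]
  | add p q hp hq =>
    simp only [map_add, grad_add, Pi.add_apply, add_mul, Finset.sum_add_distrib, hp, hq]
  | mul_X p i hp =>
    simp only [map_mul, map_X, grad_mul, D.leibniz, hp, Pi.add_apply, add_mul,
      Finset.sum_add_distrib, Pi.smul_apply, smul_eq_mul, mul_assoc, ← Finset.mul_sum]
    congr 2
    rcases i with i | i
    · simp [Pi.single_apply]
    · simp [Pi.single_apply, hD.1]

theorem hasStrictFDerivAt_expEval (f : MvPolynomial (ι ⊕ ι) ℝ) (x : ι → ℝ) :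
    HasStrictFDerivAt (fun y => expEval y f)
      (∑ j, grad x f j • (ContinuousLinearMap.proj j : (ι → ℝ) →L[ℝ] ℝ)) x := by
  classical
  induction f using MvPolynomial.induction_on with
  | C a => simpa using hasStrictFDerivAt_const (𝕜 := ℝ) a x
  | add p q hp hq =>
    simp only [map_add]
    exact (hp.add hq).congr_fderiv (by simp [add_smul, Finset.sum_add_distrib])
  | mul_X p i hp =>
    have hi : HasStrictFDerivAt (fun y => expEval y (X i))
        (∑ j, grad x (X i) j • (ContinuousLinearMap.proj j : (ι → ℝ) →L[ℝ] ℝ)) x := by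
      have h (i : ι) : HasStrictFDerivAt (fun y : ι → ℝ => y i)
          (ContinuousLinearMap.proj i : (ι → ℝ) →L[ℝ] ℝ) x :=
        hasStrictFDerivAt_apply i x
      rcases i with i | i
      · simpa [Pi.single_apply] using h i
      · simpa [Pi.single_apply] using (h i).exp
    simp only [map_mul]
    exact (hp.mul hi).congr_fderiv
      (by simp [add_smul, Finset.sum_add_distrib, mul_smul, Finset.smul_sum])

theorem continuous_expEval (f : MvPolynomial (ι ⊕ ι) ℝ) : Continuous fun y => expEval y f :=
  continuous_iff_continuousAt.2 fun x => (hasStrictFDerivAt_expEval f x).hasFDerivAt.continuousAt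

end ExpPolynomial

end ExponentialPolynomials

section
open MvPolynomial
namespace ExpPolynomial

theorem derivation_eq_zero_of_jacobian {ι : Type*} [Fintype ι] [DecidableEq ι] {A : Set ℝ}
    {x : ι → ℝ} {f : ι → MvPolynomial (ι ⊕ ι) ℝ} (hf : ∀ i, f i ∈ vanishing A x)
    (hdet : (Matrix.of fun i => grad x (f i)).det ≠ 0) {D : Derivation ℤ ℝ ℝ}
    (hD : D ∈ expDerivations A) (i : ι) : D (x i) = 0 := by
  have h := Matrix.eq_zero_of_mulVec_eq_zero (v := fun j => D (x j)) hdet <| by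
    ext i
    simpa [(hf i).2, Matrix.mulVec, dotProduct] using
      (derivation_expEval (x := x) hD (hf i).1).symm
  exact congrFun h i

/-- The relations defining the differentials of `ℝ` over `A` respecting the exponential. -/
inductive IsRelation (A : Set ℝ) : (ℝ →₀ ℝ) → Prop
  | add (a b : ℝ) : IsRelation A
      (Finsupp.single (a + b) 1 - Finsupp.single a 1 - Finsupp.single b 1)
  | mul (a b : ℝ) : IsRelation A
      (Finsupp.single (a * b) 1 - Finsupp.single b a - Finsupp.single a b)
  | const (a : ℝ) (ha : a ∈ A) : IsRelation A (Finsupp.single a 1)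
  | exp (a : ℝ) : IsRelation A
      (Finsupp.single (Real.exp a) 1 - Finsupp.single a (Real.exp a))

theorem single_mem_span_isRelation {A : Set ℝ} {a : ℝ} (h : ∀ D ∈ expDerivations A, D a = 0) :
    Finsupp.single a 1 ∈ Submodule.span ℝ {r | IsRelation A r} := by
  by_contra hna
  obtain ⟨φ, hφa, hφ⟩ := Submodule.exists_le_ker_of_notMem hna
  have hr {r} (hr : IsRelation A r) : φ r = 0 := hφ (Submodule.subset_span hr)
  have hs (a b : ℝ) : φ (Finsupp.single a b) = b * φ (Finsupp.single a 1) := by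
    rw [← smul_eq_mul, ← map_smul]; simp
  have hadd (a b : ℝ) : φ (Finsupp.single (a + b) 1) =
      φ (Finsupp.single a 1) + φ (Finsupp.single b 1) := by
    have := hr (.add a b)
    simp only [map_sub] at this
    linarith
  let d : ℝ →+ ℝ := AddMonoidHom.mk' (fun a => φ (Finsupp.single a 1)) hadd
  let D : Derivation ℤ ℝ ℝ := Derivation.mk' d.toIntLinearMap fun a b => by
    have := hr (.mul a b)
    simp only [map_sub, hs b a, hs a b] at this
    simp [d]
    linarith
  refine hφa (h D ⟨fun a => ?_, fun a ha => hr (.const a ha)⟩)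
  have := hr (.exp a)
  simp only [map_sub, hs a (Real.exp a)] at this
  change φ (Finsupp.single (Real.exp a) 1) = Real.exp a * φ (Finsupp.single a 1)
  linarith

theorem exists_single_mem_conormal {A : Set ℝ} {a : ℝ} (h : ∀ D ∈ expDerivations A, D a = 0) :
    ∃ (n : ℕ) (x : Fin (n + 1) → ℝ), x 0 = a ∧ Pi.single 0 1 ∈ conormal A x := by
  classical
  have key (r : ℝ →₀ ℝ) (hr : r ∈ Submodule.span ℝ {r | IsRelation A r}) :
      ∃ S : Finset ℝ, ∀ (n : ℕ) (x : Fin n → ℝ), Function.Injective x →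
        (S : Set ℝ) ⊆ Set.range x → (fun i => r (x i)) ∈ conormal A x := by
    have hsub {n : ℕ} {x : Fin n → ℝ} (f) (hf : f ∈ coeffsIn (Fin n) A) (h0 : expEval x f = 0) :
        grad x f ∈ conormal A x := Submodule.subset_span ⟨f, ⟨hf, h0⟩, rfl⟩
    have hX {n : ℕ} (i : Fin n ⊕ Fin n) : X i ∈ coeffsIn (Fin n) A := X_mem_coeffsIn i
    have hsingle {n : ℕ} {x : Fin n → ℝ} (hx : Function.Injective x) (i : Fin n) (c : ℝ) :
        (fun j => Finsupp.single (x i) c (x j)) = Pi.single i c := by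
      ext j
      simp [Finsupp.single_apply, Pi.single_apply, hx.eq_iff, eq_comm]
    induction hr using Submodule.span_induction with
    | zero => exact ⟨∅, fun n x _ _ => zero_mem (conormal A x)⟩
    | add r s _ _ hr hs =>
      obtain ⟨S, hS⟩ := hr
      obtain ⟨T, hT⟩ := hs
      refine ⟨S ∪ T, fun n x hx hST => ?_⟩
      rw [Finset.coe_union, Set.union_subset_iff] at hST
      exact add_mem (hS n x hx hST.1) (hT n x hx hST.2)
    | smul c r _ hr =>
      obtain ⟨S, hS⟩ := hr
      exact ⟨S, fun n x hx hxS => Submodule.smul_mem _ c (hS n x hx hxS)⟩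
    | mem r hr =>
      cases hr with
      | add a b =>
        refine ⟨{a + b, a, b}, fun n x hx hS => ?_⟩
        obtain ⟨k, hk⟩ := hS (show a + b ∈ _ by simp)
        obtain ⟨i, rfl⟩ := hS (show a ∈ _ by simp)
        obtain ⟨j, rfl⟩ := hS (show b ∈ _ by simp)
        rw [← hk]
        convert hsub (x := x) (X (Sum.inl k) - X (Sum.inl i) - X (Sum.inl j))
          (sub_mem (sub_mem (hX _) (hX _)) (hX _)) (by simp [hk]) using 1
        simp [← hsingle hx]
        rfl
      | mul a b =>
        refine ⟨{a * b, a, b}, fun n x hx hS => ?_⟩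
        obtain ⟨k, hk⟩ := hS (show a * b ∈ _ by simp)
        obtain ⟨i, rfl⟩ := hS (show a ∈ _ by simp)
        obtain ⟨j, rfl⟩ := hS (show b ∈ _ by simp)
        rw [← hk]
        convert hsub (x := x) (X (Sum.inl k) - X (Sum.inl i) * X (Sum.inl j))
          (sub_mem (hX _) (mul_mem (hX _) (hX _))) (by simp [hk]) using 1
        ext l
        simp [Finsupp.single_apply, Pi.single_apply, hx.eq_iff, eq_comm, ← sub_sub]
      | const a ha =>
        refine ⟨{a}, fun n x hx hS => ?_⟩
        obtain ⟨i, rfl⟩ := hS (show a ∈ _ by simp)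
        convert hsub (x := x) (X (Sum.inl i) - C (x i))
          (sub_mem (hX _) (C_mem_coeffsIn (Subring.subset_closure ha))) (by simp) using 1
        simp [← hsingle hx]
      | exp a =>
        refine ⟨{Real.exp a, a}, fun n x hx hS => ?_⟩
        obtain ⟨k, hk⟩ := hS (show Real.exp a ∈ _ by simp)
        obtain ⟨i, rfl⟩ := hS (show a ∈ _ by simp)
        rw [← hk]
        convert hsub (x := x) (X (Sum.inl k) - X (Sum.inr i)) (sub_mem (hX _) (hX _))
          (by simp [hk]) using 1
        simp only [grad_sub, grad_X_inl, grad_X_inr, ← hsingle hx, hk]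
        rfl
  obtain ⟨S, hS⟩ := key _ (single_mem_span_isRelation h)
  let e := (S.erase a).equivFin.symm
  have hinj : Function.Injective (Fin.cons a (fun i => (e i : ℝ)) : Fin _ → ℝ) := by
    refine Fin.cons_injective_iff.2 ⟨?_, Subtype.val_injective.comp e.injective⟩
    rintro ⟨i, hi⟩
    exact (Finset.mem_erase.1 (e i).2).1 hi
  refine ⟨_, Fin.cons a fun i => (e i : ℝ), Fin.cons_zero _ _, ?_⟩
  convert hS _ _ hinj ?_ using 1
  · ext j
    refine Fin.cases (by simp) (fun j => ?_) j
    have hj : a ≠ e j := (Finset.mem_erase.1 (e j).2).1.symm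
    simp [hj]
  · intro b hb
    by_cases hba : b = a
    · exact ⟨0, by simp [hba]⟩
    · exact ⟨(e.symm ⟨b, Finset.mem_erase.2 ⟨hba, hb⟩⟩).succ, by simp⟩

end ExpPolynomial
end

section
open MvPolynomial Set
namespace ExpPolynomial

variable {ι : Type*} [Fintype ι]

theorem expEval_eq_zero_of_hasDerivAt {κ : Type*} [Fintype κ] {I : Set (MvPolynomial (ι ⊕ ι) ℝ)}
    {γ : ℝ → ι → ℝ} (hγ : ContinuousOn γ (Icc 0 1)) {c : κ → ℝ → ℝ}
    (hc : ∀ k, ContinuousOn (c k) (Icc 0 1)) (h0 : ∀ f ∈ I, expEval (γ 0) f = 0)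
    {T : κ → MvPolynomial (ι ⊕ ι) ℝ → MvPolynomial (ι ⊕ ι) ℝ} (hT : ∀ k, ∀ f ∈ I, T k f ∈ I)
    (hI : ∀ f ∈ I, ∀ s ∈ Icc (0 : ℝ) 1,
      HasDerivAt (fun s => expEval (γ s) f) (∑ k, c k s * expEval (γ s) (T k f)) s)
    {f : MvPolynomial (ι ⊕ ι) ℝ} (hf : f ∈ I) {s : ℝ} (hs : s ∈ Icc (0 : ℝ) 1) :
    expEval (γ s) f = 0 := by
  obtain ⟨t, htI, ht⟩ := (Submodule.fg_span_iff_fg_span_finset_subset I).1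
    (IsNoetherian.noetherian (Ideal.span I))
  have hmem (f) (hf : f ∈ I) : ∃ q : MvPolynomial (ι ⊕ ι) ℝ → MvPolynomial (ι ⊕ ι) ℝ,
      ∑ u : t, q u * u = f := by
    have : f ∈ Submodule.span (MvPolynomial (ι ⊕ ι) ℝ) (t : Set _) :=
      ht ▸ Submodule.subset_span hf
    obtain ⟨q, -, hq⟩ := Submodule.mem_span_finset.1 this
    exact ⟨q, (Finset.sum_coe_sort t fun u => q u * u).trans hq⟩
  choose! q hq using hmem
  let u (s : ℝ) (f : t) : ℝ := expEval (γ s) f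
  let M (f g : t) (s : ℝ) : ℝ := ∑ k, c k s * expEval (γ s) (q (T k f) g)
  have hM (f g) : ContinuousOn (M f g) (Icc 0 1) :=
    continuousOn_finsetSum _ fun k _ => (hc k).mul ((continuous_expEval _).comp_continuousOn hγ)
  have hu (s) (hs : s ∈ Icc (0 : ℝ) 1) : HasDerivAt u (fun f => ∑ g, M f g s * u s g) s := by
    refine hasDerivAt_pi.2 fun f => (hI f (htI f.2) s hs).congr_deriv ?_
    simp_rw [M, Finset.sum_mul, u]
    rw [Finset.sum_comm]
    refine Finset.sum_congr rfl fun k _ => ?_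
    conv_lhs => rw [← hq _ (hT k f (htI f.2))]
    simp [Finset.mul_sum, mul_assoc]
  obtain ⟨K, hK⟩ := isCompact_Icc.exists_bound_of_continuousOn
    (continuousOn_finsetSum Finset.univ fun f _ =>
      continuousOn_finsetSum Finset.univ fun g _ => (hM f g).norm)
  have hzero : u s = 0 := by
    refine eq_zero_of_abs_deriv_le_mul_abs_self_of_eq_zero_right (K := K)
      (fun s hs => (hu s hs).continuousAt.continuousWithinAt)
      (fun s hs => (hu s (Ico_subset_Icc_self hs)).hasDerivWithinAt)
      (funext fun f => h0 f (htI f.2)) (fun s hs => ?_) s hs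
    refine le_trans ?_ (mul_le_mul_of_nonneg_right
      ((le_abs_self _).trans (hK s (Ico_subset_Icc_self hs))) (norm_nonneg _))
    rw [pi_norm_le_iff_of_nonneg (by positivity)]
    intro f
    refine (norm_sum_le _ _).trans ?_
    calc ∑ g, ‖M f g s * u s g‖ ≤ ∑ g, ‖M f g s‖ * ‖u s‖ := Finset.sum_le_sum fun g _ => by
          rw [norm_mul]; gcongr; exact norm_le_pi_norm _ _
      _ = (∑ g, ‖M f g s‖) * ‖u s‖ := by rw [Finset.sum_mul]
      _ ≤ _ := mul_le_mul_of_nonneg_right (Finset.single_le_sum (f := fun f => ∑ g, ‖M f g s‖)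
          (fun f _ => by positivity) (Finset.mem_univ f)) (norm_nonneg _)
  rw [← hq f hf, map_sum]
  exact Finset.sum_eq_zero fun g _ => by
    rw [map_mul, show expEval (γ s) (g : MvPolynomial (ι ⊕ ι) ℝ) = 0 from congrFun hzero g,
      mul_zero]

/-- The Jacobian matrix of a family of exponential polynomials at a real point. -/
noncomputable def jacobian (h : ι → MvPolynomial (ι ⊕ ι) ℝ) (x : ι → ℝ) : Matrix ι ι ℝ :=
  Matrix.of fun k => grad x (h k)

theorem continuous_jacobian (h : ι → MvPolynomial (ι ⊕ ι) ℝ) : Continuous (jacobian h) :=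
  continuous_matrix fun k j => continuous_expEval (totalDeriv j (h k))

variable [DecidableEq ι]

theorem hasStrictFDerivAt_jacobian (h : ι → MvPolynomial (ι ⊕ ι) ℝ) (x : ι → ℝ) :
    HasStrictFDerivAt (fun y k => expEval y (h k))
      (LinearMap.toContinuousLinearMap (Matrix.toLin' (jacobian h x))) x := by
  refine hasStrictFDerivAt_pi'.2 fun k => (hasStrictFDerivAt_expEval (h k) x).congr_fderiv ?_
  ext v
  simp [jacobian, Matrix.mulVec, dotProduct]

theorem exists_curve {h : ι → MvPolynomial (ι ⊕ ι) ℝ} {x : ι → ℝ}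
    (hdet : (jacobian h x).det ≠ 0) (T : Set ι) :
    ∃ (v : ι → ℝ) (γ : ℝ → ι → ℝ), (∀ k ∈ T, v k = 0) ∧ γ 0 = x ∧
      (∀ s ∈ Icc (0 : ℝ) 1, (jacobian h (γ s)).det ≠ 0 ∧
        HasDerivAt γ ((jacobian h (γ s))⁻¹.mulVec v) s) ∧
      ∀ k ∉ T, ∃ q : ℚ, expEval (γ 1) (h k) = q := by
  let G (y : ι → ℝ) (k : ι) : ℝ := expEval y (h k)
  let e (y : ι → ℝ) (hy : (jacobian h y).det ≠ 0) : (ι → ℝ) ≃L[ℝ] (ι → ℝ) :=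
    (Matrix.toLin'OfInv (M := (jacobian h y)⁻¹) (M' := jacobian h y)
      (Matrix.nonsing_inv_mul _ (isUnit_iff_ne_zero.2 hy))
      (Matrix.mul_nonsing_inv _ (isUnit_iff_ne_zero.2 hy))).toContinuousLinearEquiv
  have hG (y) (hy : (jacobian h y).det ≠ 0) :
      HasStrictFDerivAt G (e y hy : (ι → ℝ) →L[ℝ] (ι → ℝ)) y :=
    (hasStrictFDerivAt_jacobian h y).congr_fderiv (by ext w; simp [e])
  let Φ := (hG x hdet).toOpenPartialHomeomorph G
  have hxs : x ∈ Φ.source := (hG x hdet).mem_toOpenPartialHomeomorph_source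
  have hxt : G x ∈ Φ.target := (hG x hdet).image_mem_toOpenPartialHomeomorph_target
  have hΦx : Φ.symm (G x) = x := Φ.left_inv hxs
  have hnhds : {w | w ∈ Φ.target ∧ (jacobian h (Φ.symm w)).det ≠ 0} ∈ nhds (G x) := by
    refine Filter.inter_mem (Φ.open_target.mem_nhds hxt) ?_
    refine ((continuous_jacobian h).matrix_det.continuousAt.comp
      (Φ.continuousAt_symm hxt)).eventually_ne ?_
    simpa [hΦx] using hdet
  obtain ⟨ε, hε, hball⟩ := Metric.mem_nhds_iff.1 hnhds
  have hq (k : ι) : ∃ q : ℚ, |(q : ℝ) - G x k| < ε / 2 := by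
    obtain ⟨q, hq1, hq2⟩ := exists_rat_btwn (show G x k < G x k + ε / 2 by linarith)
    exact ⟨q, abs_lt.2 ⟨by linarith, by linarith⟩⟩
  choose q hq using hq
  classical
  let v (k : ι) : ℝ := if k ∈ T then 0 else q k - G x k
  have hv : ‖v‖ ≤ ε / 2 := (pi_norm_le_iff_of_nonneg (by positivity)).2 fun k => by
    by_cases hk : k ∈ T
    · simpa [v, hk] using (half_pos hε).le
    · simpa [v, hk] using (hq k).le
  have hseg (s) (hs : s ∈ Icc (0 : ℝ) 1) : G x + s • v ∈ Φ.target ∧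
      (jacobian h (Φ.symm (G x + s • v))).det ≠ 0 := by
    refine hball ?_
    rw [mem_ball_iff_norm, add_sub_cancel_left, norm_smul, Real.norm_of_nonneg hs.1]
    calc s * ‖v‖ ≤ 1 * (ε / 2) := by gcongr; exact hs.2
      _ < ε := by linarith
  refine ⟨v, fun s => Φ.symm (G x + s • v), fun k hk => by simp [v, hk], by simpa using hΦx,
    fun s hs => ⟨(hseg s hs).2, ?_⟩, fun k hk => ⟨q k, ?_⟩⟩
  · have h1 := Φ.hasFDerivAt_symm (hseg s hs).1 (hG _ (hseg s hs).2).hasFDerivAt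
    have h2 : HasDerivAt (fun s : ℝ => G x + s • v) v s := by
      simpa using ((hasDerivAt_id s).smul_const v).const_add (G x)
    exact (h1.comp_hasDerivAt s h2).congr_deriv rfl
  · have h1 : G (Φ.symm (G x + (1 : ℝ) • v)) = G x + (1 : ℝ) • v :=
      Φ.right_inv (hseg 1 (by simp)).1
    have := congrFun h1 k
    simpa [G, v, hk] using this

end ExpPolynomial
end

section
open MvPolynomial Set
namespace ExpPolynomial

section

variable {ι : Type*} [Fintype ι] [DecidableEq ι]

theorem exists_adapted_family (A : Set ℝ) (x : ι → ℝ) :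
    ∃ (h : ι → MvPolynomial (ι ⊕ ι) ℝ) (T : Set ι), (∀ k, h k ∈ coeffsIn ι A) ∧
      (∀ k ∈ T, expEval x (h k) = 0) ∧ (jacobian h x).det ≠ 0 ∧
      conormal A x ≤ Submodule.span ℝ ((fun k => grad x (h k)) '' T) := by
  classical
  obtain ⟨b, hbI, hbspan, hb⟩ := exists_linearIndependent ℝ (grad x '' vanishing A x)
  let std : Set (ι → ℝ) := range fun i => Pi.single i 1
  have hb' : LinearIndepOn ℝ id b := hb
  have hsub : b ⊆ b ∪ std := subset_union_left
  let c := hb'.extend hsub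
  have hc : LinearIndepOn ℝ id c := hb'.linearIndepOn_extend hsub
  have hspan : ⊤ ≤ Submodule.span ℝ (range ((↑) : c → ι → ℝ)) := by
    have h1 : Submodule.span ℝ std = ⊤ := by
      rw [← (Pi.basisFun ℝ ι).span_eq]
      exact congrArg _ (congrArg range (funext fun i => (Pi.basisFun_apply ℝ ι i).symm))
    rw [Subtype.range_coe, ← h1, Submodule.span_le]
    exact subset_union_right.trans (hb'.subset_span_extend hsub)
  let β : Module.Basis c ℝ (ι → ℝ) := Module.Basis.mk hc hspan
  let e : ι ≃ c := (Pi.basisFun ℝ ι).indexEquiv β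
  have hlift (w : c) : ∃ f ∈ coeffsIn ι A, grad x f = w ∧ ((w : ι → ℝ) ∈ b → expEval x f = 0) := by
    by_cases hw : (w : ι → ℝ) ∈ b
    · obtain ⟨f, hf, hfw⟩ := hbI hw
      exact ⟨f, hf.1, hfw, fun _ => hf.2⟩
    · obtain hw' | ⟨i, hi⟩ := hb'.extend_subset hsub w.2
      · exact absurd hw' hw
      · exact ⟨X (Sum.inl i), X_mem_coeffsIn _, by simpa using hi, fun h => absurd h hw⟩
  choose f hf hfw hf0 using hlift
  refine ⟨fun k => f (e k), {k | ((e k : c) : ι → ℝ) ∈ b}, fun k => hf _, fun k hk => hf0 _ hk,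
    ?_, ?_⟩
  · rw [← isUnit_iff_ne_zero, ← Matrix.isUnit_iff_isUnit_det,
      ← Matrix.linearIndependent_rows_iff_isUnit]
    have hrow : (jacobian (fun k => f (e k)) x).row = (fun w : c => id (w : ι → ℝ)) ∘ e := by
      ext k j
      simp [jacobian, hfw]
    rw [hrow]
    exact hc.linearIndependent.comp e e.injective
  · rw [conormal, ← hbspan, Submodule.span_le]
    intro w hw
    obtain ⟨k, hk⟩ := e.surjective ⟨w, hb'.subset_extend hsub hw⟩
    exact Submodule.subset_span ⟨k, by simpa [hk] using hw, by simp [hfw, hk]⟩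

theorem exists_expEval_mulVec_adjugate {A : Set ℝ} {h : ι → MvPolynomial (ι ⊕ ι) ℝ}
    (hh : ∀ k, h k ∈ coeffsIn ι A) (k : ι) {f : MvPolynomial (ι ⊕ ι) ℝ} (hf : f ∈ coeffsIn ι A) :
    ∃ g ∈ coeffsIn ι A, ∀ y,
      expEval y g = Matrix.vecMul (grad y f) (jacobian h y).adjugate k := by
  let J : Matrix ι ι (coeffsIn ι A) :=
    Matrix.of fun k j => ⟨totalDeriv j (h k), totalDeriv_mem_coeffsIn j (hh k)⟩
  refine ⟨∑ j, totalDeriv j f * (J.adjugate j k : MvPolynomial (ι ⊕ ι) ℝ),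
    sum_mem fun j _ => mul_mem (totalDeriv_mem_coeffsIn j hf) (J.adjugate j k).2, fun y => ?_⟩
  have hJ : jacobian h y = ((expEval y).comp (coeffsIn ι A).subtype).mapMatrix J := rfl
  rw [hJ, ← RingHom.map_adjugate]
  simp [Matrix.vecMul, dotProduct, grad]

theorem vecMul_adjugate_eq_zero {h : ι → MvPolynomial (ι ⊕ ι) ℝ} {x w : ι → ℝ} {T : Set ι}
    (hw : w ∈ Submodule.span ℝ ((fun k => grad x (h k)) '' T)) {k : ι} (hk : k ∉ T) :
    Matrix.vecMul w (jacobian h x).adjugate k = 0 := by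
  induction hw using Submodule.span_induction with
  | zero => simp
  | add a b _ _ ha hb => simp [Matrix.add_vecMul, ha, hb]
  | smul c a _ ha => simp [Matrix.smul_vecMul, ha]
  | mem w hw =>
    obtain ⟨l, hl, rfl⟩ := hw
    have := congrFun (congrFun (Matrix.mul_adjugate (jacobian h x)) l) k
    rw [Matrix.smul_apply, Matrix.one_apply_ne (fun hlk : l = k => hk (hlk ▸ hl)),
      smul_zero] at this
    exact this

theorem exists_rational_point {A : Set ℝ} {x : ι → ℝ} {i₀ : ι}
    (hi₀ : Pi.single i₀ 1 ∈ conormal A x) :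
    ∃ (h : ι → MvPolynomial (ι ⊕ ι) ℝ) (y : ι → ℝ), y i₀ = x i₀ ∧ (∀ k, h k ∈ coeffsIn ι A) ∧
      (∀ k, ∃ q : ℚ, expEval y (h k) = q) ∧ (jacobian h y).det ≠ 0 := by
  classical
  obtain ⟨h, T, hh, hT0, hdet, hspan⟩ := exists_adapted_family A x
  obtain ⟨v, γ, hv, hγ0, hγ, hrat⟩ := exists_curve hdet T
  have hγc : ContinuousOn γ (Icc 0 1) := fun s hs => (hγ s hs).2.continuousAt.continuousWithinAt
  choose! adj hadj hadj_eval using fun k f => exists_expEval_mulVec_adjugate (f := f) hh k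
  let τ (k : ι) (f : MvPolynomial (ι ⊕ ι) ℝ) := if k ∈ T then 0 else adj k f
  let c (k : ι) (s : ℝ) : ℝ := (jacobian h (γ s)).det⁻¹ * v k
  have hc (k) : ContinuousOn (c k) (Icc 0 1) :=
    (((continuous_jacobian h).matrix_det.comp_continuousOn hγc).inv₀ fun s hs => (hγ s hs).1).mul
      continuousOn_const
  have hτ (k) (f) (hf : f ∈ coeffsIn ι A) (hfx : grad x f ∈ conormal A x) :
      τ k f ∈ vanishing A x := by
    by_cases hk : k ∈ T
    · simp [τ, hk, vanishing, zero_mem]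
    · simp only [τ, if_neg hk]
      exact ⟨hadj k f hf, by rw [hadj_eval k f hf, vecMul_adjugate_eq_zero (hspan hfx) hk]⟩
  have hderiv (f) (hf : f ∈ coeffsIn ι A) (s) (hs : s ∈ Icc (0 : ℝ) 1) :
      HasDerivAt (fun s => expEval (γ s) f) (∑ k, c k s * expEval (γ s) (τ k f)) s := by
    refine ((hasStrictFDerivAt_expEval f (γ s)).hasFDerivAt.comp_hasDerivAt s
      (hγ s hs).2).congr_deriv ?_
    have h1 (k : ι) : c k s * expEval (γ s) (τ k f) = (jacobian h (γ s)).det⁻¹ *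
        (Matrix.vecMul (grad (γ s) f) (jacobian h (γ s)).adjugate k * v k) := by
      by_cases hk : k ∈ T
      · simp [c, hv k hk]
      · simp only [τ, if_neg hk, c, hadj_eval k f hf]
        ring
    simp_rw [h1, ← Finset.mul_sum]
    change _ = _ * (Matrix.vecMul (grad (γ s) f) (jacobian h (γ s)).adjugate ⬝ᵥ v)
    rw [← Matrix.dotProduct_mulVec, Matrix.inv_def, Ring.inverse_eq_inv', Matrix.smul_mulVec]
    simp [dotProduct, Finset.mul_sum]
  have hvan {f} (hf : f ∈ vanishing A x) {s} (hs : s ∈ Icc (0 : ℝ) 1) : expEval (γ s) f = 0 :=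
    expEval_eq_zero_of_hasDerivAt hγc hc (fun f hf => hγ0 ▸ hf.2)
      (fun k f hf => hτ k f hf.1 (Submodule.subset_span ⟨f, hf, rfl⟩))
      (fun f hf => hderiv f hf.1) hf hs
  refine ⟨h, γ 1, ?_, hh, fun k => ?_, (hγ 1 (by simp)).1⟩
  · have hX : X (Sum.inl i₀) ∈ coeffsIn ι A := X_mem_coeffsIn _
    have h0 (s) (hs : s ∈ Icc (0 : ℝ) 1) : HasDerivAt (fun s => γ s i₀) 0 s := by
      have := hderiv _ hX s hs
      rw [Finset.sum_eq_zero fun k _ => by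
        rw [hvan (hτ k _ hX (by simpa using hi₀)) hs, mul_zero]] at this
      simpa using this
    rw [← hγ0]
    exact constant_of_has_deriv_right_zero
      (fun s hs => (h0 s hs).continuousAt.continuousWithinAt)
      (fun s hs => (h0 s (Ico_subset_Icc_self hs)).hasDerivWithinAt) 1 (by simp)
  · by_cases hk : k ∈ T
    · exact ⟨0, by simpa using hvan ⟨hh k, hT0 k hk⟩ (by simp)⟩
    · exact hrat k hk

end

theorem jacobian_eq {ι : Type*} (f : ι → MvPolynomial (ι ⊕ ι) ℝ) (x : ι → ℝ) :
    jacobian f x = Matrix.of fun i j =>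
      eval (Sum.elim x fun j => Real.exp (x j)) (pderiv (Sum.inl j) (f i)) + Real.exp (x j) *
        eval (Sum.elim x fun j => Real.exp (x j)) (pderiv (Sum.inr j) (f i)) := by
  ext i j
  simp [jacobian, grad, totalDeriv, expEval]

theorem isExpAlgebraicOver_iff {A : Set ℝ} {a : ℝ} :
    IsExpAlgebraicOver A a ↔ ∀ D ∈ expDerivations A, D a = 0 := by
  constructor
  · rintro ⟨n, hn, x, f, rfl, hf, hf0, hdet⟩ D hD
    refine derivation_eq_zero_of_jacobian (f := f) (fun i => ⟨mem_coeffsIn.2 (hf i), hf0 i⟩) ?_ hD _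
    rwa [← jacobian_eq] at hdet
  · intro h
    obtain ⟨n, x, rfl, hx⟩ := exists_single_mem_conormal h
    obtain ⟨f, y, hy, hf, hrat, hdet⟩ := exists_rational_point hx
    choose q hq using hrat
    let g (k) : MvPolynomial (Fin (n + 1) ⊕ Fin (n + 1)) ℝ :=
      C ((q k).den : ℝ) * f k - C ((q k).num : ℝ)
    have hden (k) : ((q k).den : ℝ) ≠ 0 := by simp
    refine ⟨n + 1, n.succ_pos, y, g, hy, fun k => mem_coeffsIn.1 ?_, fun k => ?_, ?_⟩
    · exact sub_mem (mul_mem (C_mem_coeffsIn (natCast_mem _ _)) (hf k))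
        (C_mem_coeffsIn (intCast_mem _ _))
    · change expEval y (g k) = 0
      simp only [g, map_sub, map_mul, expEval_C, hq]
      rw [sub_eq_zero, mul_comm]
      exact_mod_cast Rat.mul_den_eq_num (q k)
    · have : jacobian g y = Matrix.diagonal (fun k => ((q k).den : ℝ)) * jacobian f y := by
        ext k j
        have hgrad : grad y (g k) = ((q k).den : ℝ) • grad y (f k) := by
          simp only [g, grad_sub, grad_mul, grad_C, expEval_C, smul_zero, add_zero, sub_zero]
        simp [jacobian, hgrad]
      rw [← jacobian_eq, this, Matrix.det_mul, Matrix.det_diagonal]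
      exact mul_ne_zero (Finset.prod_ne_zero_iff.2 fun k _ => hden k) hdet

end ExpPolynomial
end

theorem exists_lift_basis_ldim {F : Type*} [Field F] [CharZero F] {X Y : Set F} (hX : X.Finite) :
    ∃ x : Fin (ldim ℚ X Y) → F, (∀ i, x i ∈ X) ∧
      ∀ n : Fin (ldim ℚ X Y) → ℤ, ∑ i, n i * x i ∈ Submodule.span ℚ Y → n = 0 := by
  let π := (Submodule.span ℚ Y).mkQ
  have hspan : Submodule.map π (Submodule.span ℚ (X ∪ Y)) = Submodule.span ℚ (π '' X) := by
    rw [Submodule.span_union, Submodule.map_sup, Submodule.mkQ_map_self, sup_bot_eq,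
      Submodule.map_span]
  obtain ⟨b, hbX, hbspan, hb⟩ := exists_linearIndependent ℚ (π '' X)
  have : Fintype b := ((hX.image π).subset hbX).fintype
  have hcard : Fintype.card b = ldim ℚ X Y := by
    change _ = Module.finrank ℚ (Submodule.map π _)
    rw [hspan, ← hbspan, finrank_span_set_eq_card hb, Set.toFinset_card]
  let e : Fin (ldim ℚ X Y) ≃ b := (Fintype.equivFinOfCardEq hcard).symm
  choose x hxX hx using fun w : b => hbX w.2
  refine ⟨fun i => x (e i), fun i => hxX _, fun n hn => ?_⟩
  have h0 : ∑ i, (n i : ℚ) • ((e i : b) : F ⧸ Submodule.span ℚ Y) = 0 := by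
    have h : π (∑ i, n i * x (e i)) = 0 := (Submodule.Quotient.mk_eq_zero _).2 hn
    rw [← h, map_sum]
    refine Finset.sum_congr rfl fun i _ => ?_
    rw [← zsmul_eq_mul, map_zsmul, ← hx, Int.cast_smul_eq_zsmul]
  have h1 := Fintype.linearIndependent_iff.1 (hb.comp e e.injective) (fun i => (n i : ℚ)) h0
  exact funext fun i => by exact_mod_cast h1 i

/-- Proposition 2.1 for `F = ℝ`: if `B ∪ {p₁,…,p_m}` is an ecl-basis of `ℝ` and
`C = ecl(B)`, then for every tuple `z`:
`td(p, z, exp p, exp z / C) − ldim_ℚ(p, z / C) ≥ m`.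
(The transcendence degree here is at most `2(m+n)`, hence finite, so `Cardinal.toNat`
loses no information.) -/
theorem relative_schanuel_property (m : ℕ) (p : Fin m → ℝ) (B : Set ℝ)
    (hgen : ∀ x : ℝ, IsExpAlgebraicOver (B ∪ Set.range p) x)
    (hindB : ∀ b ∈ B, ¬ IsExpAlgebraicOver ((B \ {b}) ∪ Set.range p) b)
    (hindp : ∀ i, ¬ IsExpAlgebraicOver (B ∪ p '' {j | j ≠ i}) (p i))
    (n : ℕ) (z : Fin n → ℝ) :
    (m : ℤ) ≤
      ((td (Set.range p ∪ Set.range z ∪ (Set.range fun i => Real.exp (p i)) ∪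
            (Set.range fun i => Real.exp (z i)))
          {x : ℝ | IsExpAlgebraicOver B x}).toNat : ℤ)
      - (ldim ℚ (Set.range p ∪ Set.range z) {x : ℝ | IsExpAlgebraicOver B x} : ℤ) := by
  have hD (i : Fin m) : ∃ D ∈ ExpPolynomial.expDerivations B,
      ∀ j, D (p j) = if i = j then 1 else 0 := by
    have h := hindp i
    rw [ExpPolynomial.isExpAlgebraicOver_iff] at h
    push Not at h
    obtain ⟨D, hD, hDi⟩ := h
    refine ⟨(D (p i))⁻¹ • D, ⟨fun a => ?_, fun a ha => ?_⟩, fun j => ?_⟩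
    · simp only [Derivation.smul_apply, hD.1, smul_eq_mul]
      ring
    · simp [hD.2 a (Or.inl ha)]
    · split_ifs with hij
      · subst hij
        simp [hDi]
      · simp [hD.2 (p j) (Or.inr ⟨j, Ne.symm hij, rfl⟩)]
  choose D hDS hDp using hD
  obtain ⟨x, hxX, hx⟩ := exists_lift_basis_ldim (Y := {x : ℝ | IsExpAlgebraicOver B x})
    ((Set.finite_range p).union (Set.finite_range z))
  have hle := add_le_toNat_td (Y := {x : ℝ | IsExpAlgebraicOver B x})
    (X := Set.range p ∪ Set.range z ∪ (Set.range fun i => Real.exp (p i)) ∪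
      (Set.range fun i => Real.exp (z i)))
    (fun a => ExpPolynomial.isExpAlgebraicOver_iff)
    ((((Set.finite_range p).union (Set.finite_range z)).union (Set.finite_range _)).union
      (Set.finite_range _))
    (x := x) (y := fun i => Real.exp (x i)) (fun i => Or.inl (Or.inl (hxX i)))
    (fun i => by
      rcases hxX i with ⟨j, hj⟩ | ⟨j, hj⟩
      · exact Or.inl (Or.inr ⟨j, by simp [hj]⟩)
      · exact Or.inr ⟨j, by simp [hj]⟩)
    (fun i => Real.exp_ne_zero _) (fun D hD i => hD.1 _)
    (fun n hn => hx n (Submodule.subset_span hn))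
    (fun j => Or.inl (Or.inl (Or.inl ⟨j, rfl⟩))) hDS hDp
  simp only [Fintype.card_fin] at hle
  omega
end

section
/- Let F be a field and let K, L, E be subfields of F with E ⊆ K ∩ L such that K is linearly disjoint from L over E. Then for every finite tuple x = (x₁,…,xₙ) of elements of F and every subset A ⊆ L: ldim_K(x/L) − ldim_E(x/L) ≤ ldim_K(x/A) − ldim_E(x/A). -/
/-- `K` is linearly disjoint from `L` over `E`: every finite tuple of elements of `K`
that is linearly independent over `E` is linearly independent over `L`. -/
def LinearDisjointOver {F : Type*} [Field F] (K L E : Subfield F) : Prop :=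
  ∀ (r : ℕ) (k : Fin r → F), (∀ i, k i ∈ K) →
    LinearIndependent ↥E k → LinearIndependent ↥L k

theorem Submodule.finrank_map_mkQ_add_finrank_inf {K V : Type*} [DivisionRing K] [AddCommGroup V]
    [Module K V] (S P : Submodule K V) [FiniteDimensional K S] :
    Module.finrank K (S.map P.mkQ) + Module.finrank K ↥(S ⊓ P) = Module.finrank K S := by
  have h := LinearMap.finrank_range_add_finrank_ker (P.mkQ.domRestrict S)
  rw [LinearMap.range_domRestrict, LinearMap.ker_domRestrict, Submodule.ker_mkQ] at h
  rw [← h, ← Submodule.map_comap_subtype, Submodule.finrank_map_subtype_eq]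

/-- The kernel of the projection from `S / (S ⊓ P)` onto `S / (S ⊓ Q)` is
`(S ⊓ Q) / (S ⊓ P)`. -/
theorem Submodule.finrank_map_mkQ_eq_add_of_le {K V : Type*} [DivisionRing K] [AddCommGroup V]
    [Module K V] (S : Submodule K V) {P Q : Submodule K V} (h : P ≤ Q) [FiniteDimensional K S] :
    Module.finrank K (S.map P.mkQ) =
      Module.finrank K (S.map Q.mkQ) + Module.finrank K ((S ⊓ Q).map P.mkQ) := by
  have hP := S.finrank_map_mkQ_add_finrank_inf P
  have hQ := S.finrank_map_mkQ_add_finrank_inf Q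
  have hSQ := (S ⊓ Q).finrank_map_mkQ_add_finrank_inf P
  rw [inf_assoc, inf_eq_right.mpr h] at hSQ
  omega

theorem ldim_eq_finrank_map_span {K V : Type*} [DivisionRing K] [AddCommGroup V] [Module K V]
    (X Y : Set V) :
    ldim K X Y = Module.finrank K ((Submodule.span K X).map (Submodule.span K Y).mkQ) := by
  rw [ldim, Submodule.span_union, Submodule.map_sup, Submodule.mkQ_map_self, sup_bot_eq]

theorem ldim_eq_add_of_subset {K V : Type*} [DivisionRing K] [AddCommGroup V] [Module K V]
    {X Y Z : Set V} (hX : X.Finite) (h : Y ⊆ Z) :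
    ldim K X Y = ldim K X Z + Module.finrank K
      ((Submodule.span K X ⊓ Submodule.span K Z).map (Submodule.span K Y).mkQ) := by
  have := FiniteDimensional.span_of_finite K hX
  simp only [ldim_eq_finrank_map_span]
  exact Submodule.finrank_map_mkQ_eq_add_of_le _ (Submodule.span_mono h)

theorem exists_linearIndependent_fin_eq_sum {K V ι : Type*} [DivisionRing K] [AddCommGroup V]
    [Module K V] [Finite ι] (f : ι → V) :
    ∃ (r : ℕ) (b : Fin r → V) (c : ι → Fin r → K), LinearIndependent K b ∧
      (∀ k, b k ∈ Submodule.span K (Set.range f)) ∧ ∀ i, f i = ∑ k, c i k • b k := by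
  have := FiniteDimensional.span_of_finite K (Set.finite_range f)
  let b := Module.finBasis K (Submodule.span K (Set.range f))
  refine ⟨_, fun k => b k, fun i => b.repr ⟨f i, Submodule.subset_span ⟨i, rfl⟩⟩,
    b.linearIndependent.map' _ (Submodule.ker_subtype _), fun k => (b k).2, fun i => ?_⟩
  have := congrArg Subtype.val (b.sum_repr ⟨f i, Submodule.subset_span ⟨i, rfl⟩⟩)
  rw [Submodule.coe_sum] at this
  exact this.symm

theorem Submodule.exists_linearIndependent_mkQ_comp {K V : Type*} [DivisionRing K]
    [AddCommGroup V] [Module K V] (S P : Submodule K V) [FiniteDimensional K S] :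
    ∃ w : Fin (Module.finrank K (S.map P.mkQ)) → V,
      (∀ i, w i ∈ S) ∧ LinearIndependent K (P.mkQ ∘ w) := by
  obtain ⟨b⟩ := Nonempty.intro (Module.finBasis K (S.map P.mkQ))
  have hb := b.linearIndependent.map' _ (Submodule.ker_subtype _)
  have hlift (i) : ∃ v ∈ S, P.mkQ v = (b i : V ⧸ P) := Submodule.mem_map.mp (b i).2
  choose w hw hwb using hlift
  have hwb' : P.mkQ ∘ w = (S.map P.mkQ).subtype ∘ b := funext hwb
  exact ⟨w, hw, hwb' ▸ hb⟩

section Subfield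

variable {F : Type*} [Field F] {K L E : Subfield F}

theorem Subfield.mem_of_mem_span (hEL : E ≤ L) {A : Set F} (hA : A ⊆ L) {a : F}
    (ha : a ∈ Submodule.span E A) : a ∈ L := by
  induction ha using Submodule.span_induction with
  | mem a ha => exact hA ha
  | zero => exact L.zero_mem
  | add a b _ _ ha hb => exact L.add_mem ha hb
  | smul e a _ ha => exact L.mul_mem (hEL e.2) ha

theorem Subfield.mem_span_of_mem_span_of_le (hEK : E ≤ K) {A : Set F} {a : F}
    (ha : a ∈ Submodule.span E A) : a ∈ Submodule.span K A := by
  induction ha using Submodule.span_induction with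
  | mem a ha => exact Submodule.subset_span ha
  | zero => exact Submodule.zero_mem _
  | add a b _ _ ha hb => exact Submodule.add_mem _ ha hb
  | smul e a _ ha => exact Submodule.smul_mem _ (⟨e, hEK e.2⟩ : K) ha

/-- Linear disjointness is symmetric: `E`-independent families in `L` are `K`-independent. -/
theorem LinearDisjointOver.linearIndependent_left (h : LinearDisjointOver K L E) (hEK : E ≤ K)
    (hEL : E ≤ L) {ι : Type*} {v : ι → F} (hv : ∀ i, v i ∈ L) (hE : LinearIndependent E v) :
    LinearIndependent K v := by
  rw [linearIndependent_iff']
  intro s g hg i hi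
  obtain ⟨r, b, c, hbE, hbspan, hc⟩ :=
    exists_linearIndependent_fin_eq_sum (K := E) (fun j : s => (g j : F))
  have hb : LinearIndependent L b := h r b (fun k => Subfield.mem_of_mem_span hEK
    (Set.range_subset_iff.mpr fun j : s => (g j).2) (hbspan k)) hbE
  have hsum : ∑ k, (∑ j : s, (c j k : F) * v j) * b k = 0 := by
    calc
      _ = ∑ j : s, (g j : F) * v j := by
        simp only [hc, Finset.sum_mul, Subfield.smul_def, smul_eq_mul]
        rw [Finset.sum_comm]
        exact Finset.sum_congr rfl fun j _ => Finset.sum_congr rfl fun k _ => by ring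
      _ = ∑ j ∈ s, (g j : F) * v j := Finset.sum_coe_sort s fun j => (g j : F) * v j
      _ = 0 := by simpa only [Subfield.smul_def, smul_eq_mul] using hg
  have hcoef (k) : ∑ j : s, (c j k : F) * v j = 0 :=
    congrArg Subtype.val (Fintype.linearIndependent_iff.mp hb
      (fun k => ⟨_, L.sum_mem fun j _ => L.mul_mem (hEL (c j k).2) (hv j)⟩) hsum k)
  have hzero (k) : c ⟨i, hi⟩ k = 0 :=
    Fintype.linearIndependent_iff.mp (hE.comp ((↑) : s → ι) Subtype.val_injective)
      (fun j => c j k) (hcoef k) ⟨i, hi⟩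
  apply Subtype.ext
  simpa [hzero] using hc ⟨i, hi⟩

theorem LinearDisjointOver.linearIndependent_mkQ_span (h : LinearDisjointOver K L E)
    (hEK : E ≤ K) (hEL : E ≤ L) {A : Set F} (hA : A ⊆ L) {ι : Type*} {w : ι → F}
    (hw : ∀ i, w i ∈ L) (hE : LinearIndependent E ((Submodule.span E A).mkQ ∘ w)) :
    LinearIndependent K ((Submodule.span K A).mkQ ∘ w) := by
  obtain ⟨B, hBA, hspan, hB⟩ := exists_linearIndependent E A
  rw [← hspan] at hE
  have hspanK : Submodule.span K B = Submodule.span K A :=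
    le_antisymm (Submodule.span_mono hBA) <| Submodule.span_le.mpr fun a ha =>
      Subfield.mem_span_of_mem_span_of_le hEK (hspan ▸ Submodule.subset_span ha)
  rw [← hspanK]
  have hsum : LinearIndependent E (Sum.elim ((↑) : B → F) w) :=
    LinearIndependent.sumElim_of_quotient
      (f := fun b : B => (⟨b, Submodule.subset_span b.2⟩ : Submodule.span E B))
      (LinearIndependent.of_comp (Submodule.subtype _) hB) w hE
  have hsumK := h.linearIndependent_left hEK hEL
    (Sum.rec (fun b => hA (hBA b.2)) hw) hsum
  obtain ⟨-, hwK, hdisj⟩ := linearIndependent_sum.mp hsumK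
  refine hwK.map ?_
  rw [Submodule.ker_mkQ]
  rw [Sum.elim_comp_inl, Subtype.range_coe] at hdisj
  exact hdisj.symm

theorem LinearDisjointOver.finrank_map_mkQ_le (h : LinearDisjointOver K L E)
    (hEK : E ≤ K) (hEL : E ≤ L) {A X : Set F} (hA : A ⊆ L) (hX : X.Finite) :
    Module.finrank E
        ((Submodule.span E X ⊓ Submodule.span E L).map (Submodule.span E A).mkQ) ≤
      Module.finrank K
        ((Submodule.span K X ⊓ Submodule.span K L).map (Submodule.span K A).mkQ) := by
  have := FiniteDimensional.span_of_finite E hX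
  have := FiniteDimensional.span_of_finite K hX
  obtain ⟨w, hw, hE⟩ := Submodule.exists_linearIndependent_mkQ_comp
    (Submodule.span E X ⊓ Submodule.span E (L : Set F)) (Submodule.span E A)
  have hK := h.linearIndependent_mkQ_span hEK hEL hA
    (fun i => Subfield.mem_of_mem_span hEL subset_rfl (hw i).2) hE
  let u i : (Submodule.span K X ⊓ Submodule.span K (L : Set F)).map (Submodule.span K A).mkQ :=
    ⟨(Submodule.span K A).mkQ (w i), Submodule.mem_map_of_mem
      ⟨Subfield.mem_span_of_mem_span_of_le hEK (hw i).1,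
        Subfield.mem_span_of_mem_span_of_le hEK (hw i).2⟩⟩
  have hu : LinearIndependent K u := LinearIndependent.of_comp (Submodule.subtype _) hK
  simpa using hu.fintype_card_le_finrank

end Subfield

/-- Lemma 3.3: if `K ⊥_E L` then for every tuple `x` from `F` and every `A ⊆ L`,
`ldim_K(x/L) − ldim_E(x/L) ≤ ldim_K(x/A) − ldim_E(x/A)`. -/
theorem ldim_diff_le_of_linearDisjoint {F : Type*} [Field F] (K L E : Subfield F)
    (hE : E ≤ K ⊓ L) (hKL : LinearDisjointOver K L E)
    (n : ℕ) (x : Fin n → F) (A : Set F) (hA : A ⊆ (L : Set F)) :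
    (ldim ↥K (Set.range x) (L : Set F) : ℤ) - (ldim ↥E (Set.range x) (L : Set F) : ℤ)
      ≤ (ldim ↥K (Set.range x) A : ℤ) - (ldim ↥E (Set.range x) A : ℤ) := by
  have hEK : E ≤ K := hE.trans inf_le_left
  have hEL : E ≤ L := hE.trans inf_le_right
  have hx := Set.finite_range x
  have hle := hKL.finrank_map_mkQ_le hEK hEL hA hx
  have hK := ldim_eq_add_of_subset (K := K) hx hA
  have hE' := ldim_eq_add_of_subset (K := E) hx hA
  omega
end

section
/- Let F be a field of characteristic zero, let K be a subfield of F, let λ ∈ F be transcendental over K, and let x = (x₁,…,xₙ) ∈ Fⁿ. Then ldim_ℚ({λx₁,…,λxₙ}/{x₁,…,xₙ} ∪ K) ≥ ldim_{ℚ(λ)}({x₁,…,xₙ}/K), where ℚ(λ) denotes the subfield of F generated by λ. -/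
/-- A finite-dimensional `k`-subspace of an `L`-vector space that is stable under an element of
`L` transcendental over `k` is zero. -/
theorem Submodule.eq_bot_of_transcendental_smul_mem {k L M : Type*} [Field k] [Field L]
    [Algebra k L] [AddCommGroup M] [Module L M] [Module k M] [IsScalarTower k L M]
    {a : L} (ha : Transcendental k a) (N : Submodule k M) (hN : N.FG)
    (h : ∀ m ∈ N, a • m ∈ N) : N = ⊥ := by
  by_contra hne
  exact ha (isIntegral_of_smul_mem_submodule N hne hN a h).isAlgebraic

/-- The dimension modulo `Y` of a family of vectors that together with `Y` spans `X` is at most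
the size of the family. -/
theorem ldim_le_card_of_subset_span {k V ι : Type*} [DivisionRing k] [AddCommGroup V] [Module k V]
    [Fintype ι] {X Y : Set V} (y : ι → V)
    (h : X ⊆ Submodule.span k (Y ∪ Set.range y)) : ldim k X Y ≤ Fintype.card ι := by
  have hle : Submodule.map (Submodule.span k Y).mkQ (Submodule.span k (X ∪ Y)) ≤
      Submodule.span k (Set.range fun i => (Submodule.span k Y).mkQ (y i)) := by
    have hXY : Submodule.span k (X ∪ Y) ≤ Submodule.span k Y ⊔ Submodule.span k (Set.range y) := by
      rw [← Submodule.span_union, Submodule.span_le]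
      exact Set.union_subset h (Set.subset_union_left.trans Submodule.subset_span)
    refine (Submodule.map_mono hXY).trans ?_
    rw [Submodule.map_sup, Submodule.mkQ_map_self, bot_sup_eq, Submodule.map_span,
      ← Set.range_comp]
    rfl
  have : Module.Finite k (Submodule.span k (Set.range fun i => (Submodule.span k Y).mkQ (y i))) :=
    FiniteDimensional.span_of_finite k (Set.finite_range _)
  exact (Submodule.finrank_mono hle).trans (finrank_range_le_card _)

/-- A family `z` contains a subfamily of `ldim k (range z) Y` members that together with `Y`
spans `z`. -/
theorem exists_fin_ldim_subset_span {k V ι : Type*} [DivisionRing k] [AddCommGroup V] [Module k V]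
    [Finite ι] (z : ι → V) (Y : Set V) :
    ∃ g : Fin (ldim k (Set.range z) Y) → ι,
      Set.range z ⊆ Submodule.span k (Y ∪ Set.range (z ∘ g)) := by
  have hmap : Submodule.map (Submodule.span k Y).mkQ (Submodule.span k (Set.range z ∪ Y)) =
      Submodule.span k (Set.range ((Submodule.span k Y).mkQ ∘ z)) := by
    rw [Submodule.span_union, Submodule.map_sup, Submodule.mkQ_map_self, sup_bot_eq,
      Submodule.map_span, ← Set.range_comp]
  have : Module.Finite k (Submodule.span k (Set.range ((Submodule.span k Y).mkQ ∘ z))) :=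
    FiniteDimensional.span_of_finite k (Set.finite_range _)
  obtain ⟨f, hf, hspan, -⟩ :=
    Submodule.exists_fun_fin_finrank_span_eq k (Set.range ((Submodule.span k Y).mkQ ∘ z))
  rw [ldim, hmap]
  choose g hg using hf
  refine ⟨g, ?_⟩
  rintro _ ⟨i, rfl⟩
  have hmem : (Submodule.span k Y).mkQ (z i) ∈
      Submodule.map (Submodule.span k Y).mkQ (Submodule.span k (Set.range (z ∘ g))) := by
    rw [Submodule.map_span, ← Set.range_comp, ← Function.comp_assoc,
      show ((Submodule.span k Y).mkQ ∘ z) ∘ g = f from funext hg, hspan]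
    exact Submodule.subset_span ⟨i, rfl⟩
  rwa [← Submodule.mem_comap, Submodule.comap_map_mkQ, ← Submodule.span_union] at hmem

/-- If `λ` is transcendental over a subfield `K` of a characteristic zero field `F`,
then `ldim_ℚ(λx / x ∪ K) ≥ ldim_{ℚ(λ)}(x / K)`. -/
theorem ldim_smul_ge {F : Type*} [Field F] [CharZero F] (K : Subfield F) (l : F)
    (hl : Transcendental ↥K l) (n : ℕ) (x : Fin n → F) :
    ldim ↥(Subfield.closure {l}) (Set.range x) (K : Set F) ≤
      ldim ℚ (Set.range fun i => l * x i) (Set.range x ∪ (K : Set F)) := by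
  obtain ⟨g, hg⟩ :=
    exists_fin_ldim_subset_span (k := ℚ) (fun i => l * x i) (Set.range x ∪ (K : Set F))
  refine (ldim_le_card_of_subset_span (x ∘ g) ?_).trans (Fintype.card_fin _).le
  let a : Subfield.closure {l} := ⟨l, Subfield.subset_closure rfl⟩
  have ha : Transcendental ℚ a := fun h =>
    hl ((h.algebraMap (A := F)).extendScalars (algebraMap ℚ K).injective)
  let E := Submodule.span (Subfield.closure {l}) ((K : Set F) ∪ Set.range (x ∘ g))
  let π : F →ₗ[ℚ] F ⧸ E := E.mkQ.restrictScalars ℚ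
  let N : Submodule ℚ (F ⧸ E) := Submodule.span ℚ (Set.range (π ∘ x))
  have hzero {y : F} (hy : y ∈ E) : π y ∈ N := by
    rw [show π y = 0 from (Submodule.Quotient.mk_eq_zero E).2 hy]
    exact N.zero_mem
  have hcomap : Submodule.span ℚ (Set.range x ∪ (K : Set F) ∪
      Set.range ((fun i => l * x i) ∘ g)) ≤ N.comap π := by
    rw [Submodule.span_le]
    rintro _ ((⟨i, rfl⟩ | hy) | ⟨j, rfl⟩)
    · exact Submodule.subset_span ⟨i, rfl⟩
    · exact hzero (Submodule.subset_span (Or.inl hy))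
    · exact hzero (E.smul_mem a (Submodule.subset_span (Or.inr ⟨j, rfl⟩)))
  have hstable : ∀ m ∈ N, a • m ∈ N := by
    have : N ≤ N.comap (Algebra.lsmul ℚ ℚ (F ⧸ E) a) := by
      refine Submodule.span_le.2 ?_
      rintro _ ⟨i, rfl⟩
      exact hcomap (hg ⟨i, rfl⟩)
    exact this
  have hN : N = ⊥ := Submodule.eq_bot_of_transcendental_smul_mem ha N
    (Submodule.fg_span (Set.finite_range _)) hstable
  rintro _ ⟨i, rfl⟩
  have hi : π (x i) ∈ N := Submodule.subset_span ⟨i, rfl⟩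
  rw [hN, Submodule.mem_bot] at hi
  exact (Submodule.Quotient.mk_eq_zero E).1 hi
end

section
/- Let C be a subfield of ℝ closed under the exponential map (exp(C) ⊆ C), and let p = (p₁,…,p_m) ∈ ℝ^m and z = (z₁,…,zₙ) ∈ ℝⁿ be tuples of real numbers. Then the transcendence degree of the field generated by C ∪ {exp(z₁),…,exp(zₙ), exp(p₁),…,exp(p_m)} over the field generated by C ∪ {exp(z₁),…,exp(zₙ)} is at most ldim_ℚ({p₁,…,p_m}/C ∪ {z₁,…,zₙ}). -/
/-- The elements of a field `F` that are algebraic over a domain `R` form a subfield. -/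
noncomputable def algebraicSubfield (R : Type*) {F : Type*} [CommRing R] [IsDomain R] [Field F]
    [Algebra R F] : Subfield F where
  toSubring := (Subalgebra.algebraicClosure R F).toSubring
  inv_mem' _ hx := IsAlgebraic.inv hx

theorem algebraMap_mem_algebraicSubfield {R F : Type*} [CommRing R] [IsDomain R] [Field F]
    [Algebra R F] (r : R) : algebraMap R F r ∈ algebraicSubfield R (F := F) :=
  isAlgebraic_algebraMap r

/-- The real numbers whose exponential is algebraic over `R` form a `ℚ`-subspace of `ℝ`. -/
noncomputable def expAlgebraicSubmodule (R : Type*) [CommRing R] [IsDomain R] [Algebra R ℝ] :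
    Submodule ℚ ℝ where
  carrier := {w | IsAlgebraic R (Real.exp w)}
  zero_mem' := by simpa using isAlgebraic_one
  add_mem' {a b} ha hb := by
    simpa only [Set.mem_ofPred_eq, Real.exp_add] using IsAlgebraic.mul ha hb
  smul_mem' q w hw := by
    refine IsAlgebraic.of_pow q.den_pos ?_
    have h : Real.exp (q • w) ^ q.den = Real.exp w ^ q.num := by
      rw [← Real.exp_nat_mul, ← Real.rpow_intCast, ← Real.exp_mul, mul_comm w, Rat.smul_def,
        ← mul_assoc]
      congr 2
      exact_mod_cast Rat.den_mul_eq_num q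
    rw [h]
    exact zpow_mem (S := Subfield ℝ) (K := algebraicSubfield R) hw q.num

/-- If `X` is finite, then `X` is contained in the span of `Y` together with `ldim K X Y`
further vectors. -/
theorem exists_subset_span_union_range_ldim {K F : Type*} [DivisionRing K] [AddCommGroup F]
    [Module K F] {X : Set F} (hX : X.Finite) (Y : Set F) :
    ∃ b : Fin (ldim K X Y) → F, X ⊆ Submodule.span K (Y ∪ Set.range b) := by
  set N := Submodule.span K Y with hN
  have hmap : (Submodule.span K (X ∪ Y)).map N.mkQ = (Submodule.span K X).map N.mkQ := by
    rw [Submodule.span_union, Submodule.map_sup, ← hN, Submodule.mkQ_map_self, sup_bot_eq]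
  have : Module.Finite K (Submodule.span K X) := .span_of_finite K hX
  have : Module.Finite K ((Submodule.span K (X ∪ Y)).map N.mkQ) := by
    rw [hmap]; infer_instance
  let e := Module.finBasis K ((Submodule.span K (X ∪ Y)).map N.mkQ)
  choose b hb using fun i => N.mkQ_surjective (e i : F ⧸ N)
  refine ⟨b, fun x hx => ?_⟩
  let x' : (Submodule.span K (X ∪ Y)).map N.mkQ :=
    ⟨N.mkQ x, Submodule.mem_map_of_mem (Submodule.subset_span (.inl hx))⟩
  have hsum : N.mkQ x = N.mkQ (∑ i, e.repr x' i • b i) := by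
    have h := congrArg (Submodule.subtype _) (e.sum_repr x')
    simp only [map_sum, map_smul, Submodule.subtype_apply] at h
    simp only [map_sum, map_smul, hb]
    exact h.symm
  have hdiff : x - ∑ i, e.repr x' i • b i ∈ N := by
    rwa [← Submodule.Quotient.eq]
  rw [Submodule.span_union, SetLike.mem_coe, ← sub_add_cancel x (∑ i, e.repr x' i • b i)]
  exact Submodule.add_mem_sup hdiff (Submodule.sum_mem _ fun i _ =>
    Submodule.smul_mem _ _ (Submodule.subset_span ⟨i, rfl⟩))

/-- If every element of `X` is algebraic over the `ℚ(Y)`-algebra generated by `d` elements,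
then `td X Y ≤ d`. -/
theorem td_le_of_isAlgebraic_adjoin {F : Type*} [Field F] {X Y : Set F} {d : ℕ} (t : Fin d → F)
    (h : ∀ x ∈ X, IsAlgebraic (Algebra.adjoin (Subfield.closure Y) (Set.range t)) x) :
    td X Y ≤ d := by
  refine ciSup_le' fun ⟨s, hs, hind⟩ => ?_
  have hcl : (Subfield.closure (X ∪ Y) : Set F) ⊆
      (AlgebraicIndependent.matroid (Subfield.closure Y) F).closure (Set.range t) := by
    rw [AlgebraicIndependent.matroid_closure_eq]
    change Subfield.closure (X ∪ Y) ≤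
      algebraicSubfield (Algebra.adjoin (Subfield.closure Y) (Set.range t))
    refine Subfield.closure_le.2 (Set.union_subset h fun y hy => ?_)
    exact algebraMap_mem_algebraicSubfield (algebraMap (Subfield.closure Y) _
      ⟨y, Subfield.subset_closure hy⟩)
  have hindep : (AlgebraicIndependent.matroid (Subfield.closure Y) F).Indep s := hind
  have hle : s.encard ≤ d := calc
    s.encard ≤ _ := hindep.encard_le_eRk_of_subset (hs.trans hcl)
    _ = _ := Matroid.eRk_closure_eq _ _
    _ ≤ (Set.range t).encard := Matroid.eRk_le_encard _ _
    _ ≤ d := by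
      rw [← Set.image_univ]
      exact (Set.encard_image_le _ _).trans (by simp)
  have hfin : s.Finite := Set.finite_of_encard_le_coe hle
  rw [← hfin.cast_ncard_eq] at hle
  rw [← Set.cast_ncard hfin]
  exact_mod_cast hle

/-- Inequality (2): if `C ⊆ ℝ` is a subfield closed under `exp`, then
`td(exp p / C ∪ exp z) ≤ ldim_ℚ(p / C ∪ z)`. -/
theorem td_exp_le_ldim (C : Subfield ℝ) (hC : ∀ c ∈ C, Real.exp c ∈ C)
    (m n : ℕ) (p : Fin m → ℝ) (z : Fin n → ℝ) :
    td (Set.range fun i => Real.exp (p i))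
        ((C : Set ℝ) ∪ Set.range fun i => Real.exp (z i))
      ≤ (ldim ℚ (Set.range p) ((C : Set ℝ) ∪ Set.range z) : Cardinal) := by
  obtain ⟨b, hb⟩ := exists_subset_span_union_range_ldim (K := ℚ) (Set.finite_range p)
    ((C : Set ℝ) ∪ Set.range z)
  refine td_le_of_isAlgebraic_adjoin (fun i => Real.exp (b i)) ?_
  set K := Subfield.closure ((C : Set ℝ) ∪ Set.range fun i => Real.exp (z i))
  set R := Algebra.adjoin K (Set.range fun i => Real.exp (b i))
  have hK : ∀ w, Real.exp w ∈ K → w ∈ expAlgebraicSubmodule R := fun w hw =>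
    isAlgebraic_algebraMap (algebraMap K R ⟨_, hw⟩)
  have hspan : Submodule.span ℚ ((C : Set ℝ) ∪ Set.range z ∪ Set.range b) ≤
      expAlgebraicSubmodule R := by
    refine Submodule.span_le.2 (Set.union_subset (Set.union_subset ?_ ?_) ?_)
    · exact fun c hc => hK c (Subfield.subset_closure (.inl (hC c hc)))
    · rintro _ ⟨i, rfl⟩
      exact hK _ (Subfield.subset_closure (.inr ⟨i, rfl⟩))
    · rintro _ ⟨i, rfl⟩
      exact isAlgebraic_algebraMap (⟨_, Algebra.subset_adjoin ⟨i, rfl⟩⟩ : R)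
  rintro _ ⟨i, rfl⟩
  exact hspan (hb ⟨i, rfl⟩)
end
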